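/- arXiv:1001.1805 — 8 statements merged into one kernel-verified Lean document; each statement's English description precedes it below -/
import Mathlib

section
/- (Hopf lemma, interior-ball form.) Let Ω ⊆ ℝ^N be open, let u be harmonic on Ω and continuous on the closure of Ω. Let x₀ ∈ Ω and R > 0 be such that the open ball B(x₀, R) is contained in Ω, and let P be a point with |P − x₀| = R and P in the boundary of Ω. Assume u(x) > u(P) for every x ∈ B(x₀, R). Then, with ν = (P − x₀)/R the outward unit normal of the ball at P, there exists a constant c > 0 such that u(x₀ + r·ν) − u(P) ≥ c·(R − r) for all r ∈ [0, R). In particular, if the directional derivative ∂u/∂ν(P) exists, it is strictly negative. -/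
open Metric Set

/-- A real-valued function on `ℝ^N` is harmonic on an open set `Ω` if it is `C²`
there and its Laplacian (the sum of the pure second partial derivatives) vanishes
identically on `Ω`. -/
def IsHarmonicOnEuclid {N : ℕ} (u : EuclideanSpace ℝ (Fin N) → ℝ)
    (Ω : Set (EuclideanSpace ℝ (Fin N))) : Prop :=
  ContDiffOn ℝ 2 u Ω ∧
    ∀ x ∈ Ω,
      (∑ i : Fin N,
        fderiv ℝ (fun y => fderiv ℝ u y (EuclideanSpace.single i (1 : ℝ))) x
          (EuclideanSpace.single i (1 : ℝ))) = 0

/-- The second-order necessary condition at a local minimum, on the real line. -/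
theorem IsLocalMin.deriv_deriv_nonneg {f : ℝ → ℝ} {a : ℝ} (h : IsLocalMin f a)
    (hc : ContinuousAt f a) : 0 ≤ deriv (deriv f) a := by
  by_contra! hneg
  have hmax : IsLocalMax f a := isLocalMax_of_deriv_deriv_neg hneg h.deriv_eq_zero hc
  have hconst : f =ᶠ[nhds a] fun _ => f a := by
    filter_upwards [h, hmax] with x h₁ h₂ using le_antisymm h₂ h₁
  have hzero : deriv (deriv f) a = 0 := by
    rw [hconst.deriv.deriv_eq]
    simp
  exact hneg.ne hzero

/-- At a local minimum of a twice differentiable function, the pure second directional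
derivatives are nonnegative. -/
theorem IsLocalMin.fderiv_fderiv_apply_nonneg {E : Type*} [NormedAddCommGroup E]
    [NormedSpace ℝ E] {f : E → ℝ} {x : E} (h : IsLocalMin f x) (hf : ContDiffAt ℝ 2 f x) (v : E) :
    0 ≤ fderiv ℝ (fun y => fderiv ℝ f y v) x v := by
  have hline : ∀ t : ℝ, HasDerivAt (fun s : ℝ => x + s • v) v t := fun t => by
    simpa using ((hasDerivAt_id t).smul_const v).const_add x
  have hx : x + (0 : ℝ) • v = x := by simp
  have htend : Filter.Tendsto (fun s : ℝ => x + s • v) (nhds 0) (nhds x) := by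
    simpa only [ContinuousAt, hx] using (hline 0).continuousAt
  have hd : deriv (fun s : ℝ => f (x + s • v)) =ᶠ[nhds 0] fun s => fderiv ℝ f (x + s • v) v := by
    filter_upwards [htend.eventually (hf.eventually (by simp))] with s hs
    exact ((hs.differentiableAt (by simp)).hasFDerivAt.comp_hasDerivAt s (hline s)).deriv
  have hdiff : DifferentiableAt ℝ (fun y => fderiv ℝ f y v) (x + (0 : ℝ) • v) := by
    rw [hx]
    exact ((hf.fderiv_right (m := 1) (by norm_num)).differentiableAt (by simp)).clm_apply
      (differentiableAt_const v)
  have hdd : deriv (deriv fun s : ℝ => f (x + s • v)) 0 = fderiv ℝ (fun y => fderiv ℝ f y v) x v := by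
    rw [hd.deriv_eq]
    simpa only [hx, Function.comp_def] using (hdiff.hasFDerivAt.comp_hasDerivAt 0 (hline 0)).deriv
  rw [← hdd]
  apply IsLocalMin.deriv_deriv_nonneg
  · have := htend.eventually h
    simpa [IsLocalMin, IsMinFilter] using this
  · exact ContinuousAt.comp (g := f) (by simpa using hf.continuousAt) (hline 0).continuousAt

section GaussianBarrier

variable {E : Type*} [NormedAddCommGroup E] [InnerProductSpace ℝ E]

theorem hasFDerivAt_exp_neg_mul_norm_sub_sq (α : ℝ) (x₀ y : E) :
    HasFDerivAt (fun y : E => Real.exp (-α * ‖y - x₀‖ ^ 2))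
      ((Real.exp (-α * ‖y - x₀‖ ^ 2) * (-2 * α)) • innerSL ℝ (y - x₀)) y := by
  have h := (((hasFDerivAt_id y).sub_const x₀).norm_sq.const_mul (-α)).exp
  refine h.congr_fderiv ?_
  ext v
  simp
  ring

theorem fderiv_fderiv_exp_neg_mul_norm_sub_sq (α : ℝ) (x₀ y v : E) :
    fderiv ℝ (fun y => fderiv ℝ (fun y : E => Real.exp (-α * ‖y - x₀‖ ^ 2)) y v) y v =
      Real.exp (-α * ‖y - x₀‖ ^ 2) * (4 * α ^ 2 * inner ℝ (y - x₀) v ^ 2 - 2 * α * ‖v‖ ^ 2) := by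
  have h₁ : (fun y => fderiv ℝ (fun y : E => Real.exp (-α * ‖y - x₀‖ ^ 2)) y v) =
      fun y => Real.exp (-α * ‖y - x₀‖ ^ 2) * (-2 * α * inner ℝ (y - x₀) v) := by
    funext y
    rw [(hasFDerivAt_exp_neg_mul_norm_sub_sq α x₀ y).fderiv]
    simp only [smul_apply, innerSL_apply_apply, smul_eq_mul]
    ring
  have h₂ : HasFDerivAt (fun y : E => -2 * α * inner ℝ (y - x₀) v) ((-2 * α) • innerSL ℝ v) y := by
    have h := ((innerSL ℝ v).hasFDerivAt.comp y ((hasFDerivAt_id y).sub_const x₀)).const_mul (-2 * α)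
    refine (h.congr_fderiv (by ext; simp)).congr_of_eventuallyEq (.of_forall fun z => ?_)
    simp [real_inner_comm]
  rw [h₁]
  refine (congrArg (fun L : E →L[ℝ] ℝ => L v)
    ((hasFDerivAt_exp_neg_mul_norm_sub_sq α x₀ y).mul h₂).fderiv).trans ?_
  simp only [add_apply, smul_apply, innerSL_apply_apply,
    smul_eq_mul, real_inner_self_eq_norm_sq]
  ring

theorem contDiff_exp_neg_mul_norm_sub_sq (α : ℝ) (x₀ : E) :
    ContDiff ℝ 2 fun y : E => Real.exp (-α * ‖y - x₀‖ ^ 2) :=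
  (contDiff_const.mul ((contDiff_id.sub contDiff_const).norm_sq ℝ)).exp

end GaussianBarrier

theorem sum_fderiv_fderiv_exp_neg_mul_norm_sub_sq {N : ℕ} (α : ℝ)
    (x₀ y : EuclideanSpace ℝ (Fin N)) :
    ∑ i : Fin N, fderiv ℝ (fun y => fderiv ℝ
        (fun y : EuclideanSpace ℝ (Fin N) => Real.exp (-α * ‖y - x₀‖ ^ 2)) y
          (EuclideanSpace.single i (1 : ℝ))) y (EuclideanSpace.single i (1 : ℝ)) =
      Real.exp (-α * ‖y - x₀‖ ^ 2) * (4 * α ^ 2 * ‖y - x₀‖ ^ 2 - 2 * α * N) := by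
  simp_rw [fderiv_fderiv_exp_neg_mul_norm_sub_sq]
  rw [← Finset.mul_sum, Finset.sum_sub_distrib, ← Finset.mul_sum]
  rw [EuclideanSpace.norm_sq_eq (y - x₀)]
  simp [EuclideanSpace.inner_single_right]
  ring_nf

/-- A harmonic function minus a positive multiple of the Gaussian barrier has no local minimum
where the barrier is strictly subharmonic. -/
theorem IsHarmonicOnEuclid.not_isLocalMin_sub_exp {N : ℕ} {Ω : Set (EuclideanSpace ℝ (Fin N))}
    {u : EuclideanSpace ℝ (Fin N) → ℝ} (hu : IsHarmonicOnEuclid u Ω) (hΩ : IsOpen Ω)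
    {x₀ x : EuclideanSpace ℝ (Fin N)} (hx : x ∈ Ω) {ε α : ℝ} (hε : 0 < ε) (hα : 0 < α)
    (hαx : N < 2 * α * ‖x - x₀‖ ^ 2) :
    ¬ IsLocalMin (fun y => u y - ε * Real.exp (-α * ‖y - x₀‖ ^ 2)) x := by
  intro hmin
  have hb := contDiff_exp_neg_mul_norm_sub_sq α x₀
  set b : EuclideanSpace ℝ (Fin N) → ℝ := fun y => Real.exp (-α * ‖y - x₀‖ ^ 2) with hb_def
  change IsLocalMin (fun y => u y - ε * b y) x at hmin
  have huC : ContDiffAt ℝ 2 u x := hu.1.contDiffAt (hΩ.mem_nhds hx)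
  have hdir : ∀ v : EuclideanSpace ℝ (Fin N),
      fderiv ℝ (fun y => fderiv ℝ (fun y => u y - ε * b y) y v) x v =
        fderiv ℝ (fun y => fderiv ℝ u y v) x v - ε * fderiv ℝ (fun y => fderiv ℝ b y v) x v := by
    intro v
    have hfst : (fun y => fderiv ℝ (fun y => u y - ε * b y) y v) =ᶠ[nhds x]
        fun y => fderiv ℝ u y v - ε * fderiv ℝ b y v := by
      filter_upwards [huC.eventually (by simp)] with y hy
      have := (hy.differentiableAt (by simp)).hasFDerivAt.sub
        ((hb.differentiable (by simp) y).hasFDerivAt.const_mul ε)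
      exact congrArg (fun L : EuclideanSpace ℝ (Fin N) →L[ℝ] ℝ => L v) this.fderiv
    have hdu : DifferentiableAt ℝ (fun y => fderiv ℝ u y v) x :=
      ((huC.fderiv_right (m := 1) (by norm_num)).differentiableAt (by simp)).clm_apply
        (differentiableAt_const v)
    have hdb : DifferentiableAt ℝ (fun y => fderiv ℝ b y v) x :=
      ((hb.contDiffAt.fderiv_right (m := 1) (by norm_num)).differentiableAt (by simp)).clm_apply
        (differentiableAt_const v)
    rw [hfst.fderiv_eq]
    exact congrArg (fun L : EuclideanSpace ℝ (Fin N) →L[ℝ] ℝ => L v)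
      (hdu.hasFDerivAt.sub (hdb.hasFDerivAt.const_mul ε)).fderiv
  have hnonneg := Finset.sum_nonneg fun (i : Fin N) (_ : i ∈ Finset.univ) =>
    hmin.fderiv_fderiv_apply_nonneg (huC.sub (contDiffAt_const.mul hb.contDiffAt))
      (EuclideanSpace.single i (1 : ℝ))
  simp only [hdir] at hnonneg
  rw [Finset.sum_sub_distrib, hu.2 x hx, ← Finset.mul_sum, hb_def,
    sum_fderiv_fderiv_exp_neg_mul_norm_sub_sq] at hnonneg
  have : 0 < ε * (Real.exp (-α * ‖x - x₀‖ ^ 2) * (4 * α ^ 2 * ‖x - x₀‖ ^ 2 - 2 * α * N)) := by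
    have : 0 < 4 * α ^ 2 * ‖x - x₀‖ ^ 2 - 2 * α * N := by nlinarith
    positivity
  linarith

/-- A harmonic function is bounded below on an annulus by a rescaled Gaussian barrier, given
lower bounds on the two boundary spheres. -/
theorem IsHarmonicOnEuclid.exp_barrier_le {N : ℕ} {Ω : Set (EuclideanSpace ℝ (Fin N))}
    {u : EuclideanSpace ℝ (Fin N) → ℝ} (hu : IsHarmonicOnEuclid u Ω) (hΩ : IsOpen Ω)
    {x₀ : EuclideanSpace ℝ (Fin N)} {ρ R ε α a : ℝ} (hball : ball x₀ R ⊆ Ω)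
    (hcont : ContinuousOn u (closedBall x₀ R)) (hρ : 0 < ρ) (hε : 0 < ε) (hα : 0 < α)
    (hαρ : N < 2 * α * ρ ^ 2)
    (hinner : ∀ x, dist x x₀ = ρ → a + ε ≤ u x) (houter : ∀ x, dist x x₀ = R → a ≤ u x)
    {x : EuclideanSpace ℝ (Fin N)} (hρx : ρ ≤ dist x x₀) (hxR : dist x x₀ ≤ R) :
    a + ε * (Real.exp (-α * dist x x₀ ^ 2) - Real.exp (-α * R ^ 2)) ≤ u x := by
  set w : EuclideanSpace ℝ (Fin N) → ℝ := fun y => u y - ε * Real.exp (-α * ‖y - x₀‖ ^ 2)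
    with hw_def
  set A : Set (EuclideanSpace ℝ (Fin N)) := closedBall x₀ R ∩ {y | ρ ≤ dist y x₀}
  have hA : IsCompact A := (isCompact_closedBall x₀ R).inter_right
    (isClosed_le continuous_const (continuous_id.dist continuous_const))
  have hwA : ContinuousOn w A := (hcont.mono inter_subset_left).sub
    (continuous_const.mul (contDiff_exp_neg_mul_norm_sub_sq α x₀).continuous).continuousOn
  obtain ⟨z, ⟨hzR, hρz⟩, hz⟩ := hA.exists_isMinOn ⟨x, hxR, hρx⟩ hwA
  have hwz : a - ε * Real.exp (-α * R ^ 2) ≤ w z := by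
    rcases (show ρ ≤ dist z x₀ from hρz).eq_or_lt with h | h
    · have h₁ := hinner z h.symm
      have h₂ : Real.exp (-α * ‖z - x₀‖ ^ 2) ≤ 1 := Real.exp_le_one_iff.2 (by
        have : 0 ≤ α * ‖z - x₀‖ ^ 2 := by positivity
        linarith)
      have h₃ : 0 < ε * Real.exp (-α * R ^ 2) := by positivity
      simp only [hw_def]
      nlinarith
    rcases (mem_closedBall.1 hzR).eq_or_lt with h' | h'
    · have := houter z h'
      simp only [hw_def, ← dist_eq_norm, h']
      linarith
    · refine absurd ?_ (hu.not_isLocalMin_sub_exp hΩ (hball h') (x₀ := x₀) hε hα ?_)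
      · refine hz.isLocalMin (Filter.inter_mem (closedBall_mem_nhds_of_mem h') ?_)
        filter_upwards [(isOpen_lt continuous_const
          (continuous_id.dist continuous_const)).mem_nhds h] with y hy using le_of_lt hy
      · rw [← dist_eq_norm]
        refine hαρ.trans_le ?_
        gcongr
  have hwx : w z ≤ w x := hz ⟨hxR, hρx⟩
  simp only [hw_def, ← dist_eq_norm] at hwx hwz
  linarith


/-- **Hopf lemma, interior-ball form.**  If `u` is harmonic on an open set `Ω`,
continuous on its closure, `B(x₀,R) ⊆ Ω`, `P` is a boundary point of `Ω` on the
sphere of that ball, and `u > u(P)` throughout the ball, then with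
`ν = (P - x₀)/R` there is `c > 0` with `u(x₀ + r ν) - u(P) ≥ c (R - r)` for
`0 ≤ r < R`; in particular any one-sided directional derivative of `u` at `P`
in the direction `ν` (taken from inside the ball) is strictly negative. -/
theorem hopf_lemma_interior_ball {N : ℕ}
    (Ω : Set (EuclideanSpace ℝ (Fin N))) (hΩ : IsOpen Ω)
    (u : EuclideanSpace ℝ (Fin N) → ℝ)
    (hu : IsHarmonicOnEuclid u Ω)
    (hu_cont : ContinuousOn u (closure Ω))
    (x₀ : EuclideanSpace ℝ (Fin N)) (R : ℝ) (hR : 0 < R)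
    (hball : ball x₀ R ⊆ Ω)
    (P : EuclideanSpace ℝ (Fin N))
    (hP_dist : dist P x₀ = R) (hP_bd : P ∈ frontier Ω)
    (hmin : ∀ x ∈ ball x₀ R, u P < u x) :
    (∃ c > (0 : ℝ), ∀ r ∈ Ico (0 : ℝ) R,
        c * (R - r) ≤ u (x₀ + r • (R⁻¹ • (P - x₀))) - u P) ∧
      (∀ d : ℝ,
        Filter.Tendsto (fun t : ℝ => (u (P + t • (R⁻¹ • (P - x₀))) - u P) / t)
          (nhdsWithin 0 (Iio (0 : ℝ))) (nhds d) → d < 0) := by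
  have hclosed : closedBall x₀ R ⊆ closure Ω := by
    rw [← closure_ball x₀ hR.ne']
    exact closure_mono hball
  have hcont : ContinuousOn u (closedBall x₀ R) := hu_cont.mono hclosed
  have hge : ∀ x ∈ closedBall x₀ R, u P ≤ u x := by
    intro x hx
    rw [← closure_ball x₀ hR.ne'] at hx hcont
    exact le_on_closure (fun y hy => (hmin y hy).le) continuousOn_const hcont hx
  obtain ⟨z, hz, hzmin⟩ := (isCompact_closedBall x₀ (R / 2)).exists_isMinOn
    ⟨x₀, mem_closedBall_self (by positivity)⟩
    (hcont.mono (closedBall_subset_closedBall (by linarith)))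
  set m : ℝ := u z - u P with hm_def
  have hm : 0 < m := sub_pos.2 (hmin z (closedBall_subset_ball (by linarith) hz))
  have hinner : ∀ x, dist x x₀ ≤ R / 2 → u P + m ≤ u x := by
    intro x hx
    have : u z ≤ u x := hzmin hx
    linarith
  obtain ⟨α, hα, hαR⟩ : ∃ α : ℝ, 0 < α ∧ N < 2 * α * (R / 2) ^ 2 := by
    refine ⟨2 * (N + 1) / R ^ 2, by positivity, ?_⟩
    have : 2 * (2 * (N + 1) / R ^ 2) * (R / 2) ^ 2 = (N + 1 : ℝ) := by
      field_simp
    linarith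
  have hPR : ‖P - x₀‖ = R := by rw [← dist_eq_norm, hP_dist]
  have hdist : ∀ r : ℝ, 0 ≤ r → dist (x₀ + r • (R⁻¹ • (P - x₀))) x₀ = r := by
    intro r hr
    rw [dist_eq_norm, add_sub_cancel_left, norm_smul, norm_smul, hPR, Real.norm_of_nonneg hr,
      Real.norm_of_nonneg (inv_nonneg.2 hR.le), inv_mul_cancel₀ hR.ne', mul_one]
  have hlower : ∃ c > (0 : ℝ), ∀ r ∈ Ico (0 : ℝ) R,
      c * (R - r) ≤ u (x₀ + r • (R⁻¹ • (P - x₀))) - u P := by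
    refine ⟨min (m / R) (m * Real.exp (-α * R ^ 2) * α * R), by positivity, fun r hr => ?_⟩
    have hrR : 0 < R - r := sub_pos.2 hr.2
    rcases le_total r (R / 2) with h | h
    · have h₁ := hinner _ ((hdist r hr.1).trans_le h)
      calc min (m / R) (m * Real.exp (-α * R ^ 2) * α * R) * (R - r) ≤ m / R * R := by
            gcongr
            · exact min_le_left _ _
            · linarith [hr.1]
        _ = m := div_mul_cancel₀ m hR.ne'
        _ ≤ _ := by linarith
    · have h₁ := hu.exp_barrier_le hΩ hball hcont (by positivity) hm hα hαR
        (fun x hx => hinner x hx.le) (fun x hx => hge x hx.le)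
        (x := x₀ + r • (R⁻¹ • (P - x₀))) (by rwa [hdist r hr.1]) (by rw [hdist r hr.1]; exact hr.2.le)
      rw [hdist r hr.1] at h₁
      have h₂ : Real.exp (-α * R ^ 2) * (α * (R * (R - r))) ≤
          Real.exp (-α * r ^ 2) - Real.exp (-α * R ^ 2) := by
        have h₃ : Real.exp (-α * r ^ 2) =
            Real.exp (-α * R ^ 2) * Real.exp (α * (R ^ 2 - r ^ 2)) := by
          rw [← Real.exp_add]
          ring_nf
        have h₄ : α * (R * (R - r)) ≤ α * (R ^ 2 - r ^ 2) := by
          gcongr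
          nlinarith [hr.1]
        have h₅ := Real.add_one_le_exp (α * (R ^ 2 - r ^ 2))
        rw [h₃]
        nlinarith [Real.exp_pos (-α * R ^ 2)]
      calc min (m / R) (m * Real.exp (-α * R ^ 2) * α * R) * (R - r)
          ≤ m * Real.exp (-α * R ^ 2) * α * R * (R - r) := by
            gcongr
            exact min_le_right _ _
        _ = m * (Real.exp (-α * R ^ 2) * (α * (R * (R - r)))) := by ring
        _ ≤ m * (Real.exp (-α * r ^ 2) - Real.exp (-α * R ^ 2)) := by gcongr
        _ ≤ _ := by linarith
  refine ⟨hlower, fun d hd => ?_⟩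
  obtain ⟨c, hc, hlow⟩ := hlower
  suffices d ≤ -c by linarith
  refine le_of_tendsto hd ?_
  filter_upwards [Ioo_mem_nhdsLT (neg_lt_zero.2 hR)] with t ht
  have h := hlow (R + t) ⟨by linarith [ht.1], by linarith [ht.2]⟩
  have hpt : x₀ + (R + t) • (R⁻¹ • (P - x₀)) = P + t • (R⁻¹ • (P - x₀)) := by
    rw [add_smul, smul_inv_smul₀ hR.ne']
    abel
  rw [hpt] at h
  rw [div_le_iff_of_neg ht.2]
  linarith
end

section
/- (Löwner.) Let f : D → D be holomorphic with f(0) = 0. Let A be a nontrivial closed arc of the unit circle ∂D, and suppose f extends continuously to D ∪ A with f(A) ⊆ ∂D. Then the length of the arc f(A) is at least the length of A; that is, the one-dimensional Hausdorff measure of f(A) satisfies H¹(f(A)) ≥ H¹(A). -/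
open Complex Metric Set MeasureTheory

open Filter Topology ComplexConjugate

/-- Every element of the span of the Fourier monomials is the boundary value of the sum of an
entire function and the conjugate of an entire function. -/
lemma exists_entire_of_mem_span_fourier {q : C(AddCircle (1 : ℝ), ℂ)}
    (hq : q ∈ Submodule.span ℂ (range (@fourier (1 : ℝ)))) :
    ∃ p₁ p₂ : ℂ → ℂ, Differentiable ℂ p₁ ∧ Differentiable ℂ p₂ ∧
      ∀ x, q x = p₁ (AddCircle.toCircle x) + conj (p₂ (AddCircle.toCircle x)) := by
  induction hq using Submodule.span_induction with
  | mem q hq =>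
    obtain ⟨n, rfl⟩ := hq
    obtain ⟨n, rfl | rfl⟩ := n.eq_nat_or_neg
    · exact ⟨fun z => z ^ n, 0, by fun_prop, differentiable_const 0, fun x => by
        simp [fourier_apply, AddCircle.toCircle_nsmul]⟩
    · refine ⟨0, fun z => z ^ n, differentiable_const 0, by fun_prop, fun x => ?_⟩
      rw [fourier_neg]
      simp [fourier_apply, AddCircle.toCircle_nsmul]
  | zero => exact ⟨0, 0, differentiable_const 0, differentiable_const 0, fun x => by simp⟩
  | add q₁ q₂ _ _ h₁ h₂ =>
    obtain ⟨a₁, b₁, ha₁, hb₁, h₁⟩ := h₁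
    obtain ⟨a₂, b₂, ha₂, hb₂, h₂⟩ := h₂
    refine ⟨a₁ + a₂, b₁ + b₂, ha₁.add ha₂, hb₁.add hb₂, fun x => ?_⟩
    simp only [ContinuousMap.add_apply, h₁, h₂, Pi.add_apply, map_add]
    ring
  | smul c q _ h =>
    obtain ⟨a, b, ha, hb, h⟩ := h
    refine ⟨fun z => c * a z, fun z => conj c * b z, ha.const_mul _, hb.const_mul _, fun x => ?_⟩
    simp only [ContinuousMap.smul_apply, h, smul_eq_mul, map_mul, Complex.conj_conj]
    ring

/-- Real parts of entire functions are uniformly dense in the continuous functions on the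
circle. -/
lemma exists_entire_re_approx (g : C(Circle, ℝ)) {ε : ℝ} (hε : 0 < ε) :
    ∃ p : ℂ → ℂ, Differentiable ℂ p ∧ ∀ z : Circle, |(p z).re - g z| ≤ ε := by
  let e := AddCircle.homeomorphCircle (one_ne_zero : (1 : ℝ) ≠ 0)
  let G : C(AddCircle (1 : ℝ), ℂ) := ⟨fun x => (g (e x) : ℂ), by fun_prop⟩
  have hG : G ∈ closure (Submodule.span ℂ (range (@fourier (1 : ℝ))) : Set _) := by
    rw [← Submodule.topologicalClosure_coe, span_fourier_closure_eq_top]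
    trivial
  obtain ⟨q, hq, hqG⟩ := Metric.mem_closure_iff.1 hG ε hε
  obtain ⟨p₁, p₂, hp₁, hp₂, hp⟩ := exists_entire_of_mem_span_fourier hq
  refine ⟨p₁ + p₂, hp₁.add hp₂, fun z => ?_⟩
  obtain ⟨x, rfl⟩ := e.surjective z
  have hd : ‖q x - G x‖ ≤ ε := by
    rw [← dist_eq_norm, dist_comm]
    exact (ContinuousMap.dist_apply_le_dist x).trans hqG.le
  have hre : (q x - G x).re = ((p₁ + p₂) (e x)).re - g (e x) := by
    simp [hp, G, e, AddCircle.homeomorphCircle_apply]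
  rw [← hre]
  exact (Complex.abs_re_le_norm _).trans hd

/-- If the real part of an entire function is bounded below on the unit circle, the same bound
holds on the unit disc. -/
lemma le_re_of_forall_circle_le {p : ℂ → ℂ} (hp : Differentiable ℂ p) {c : ℝ}
    (hc : ∀ z : Circle, c ≤ (p z).re) {w : ℂ} (hw : w ∈ ball (0 : ℂ) 1) : c ≤ (p w).re := by
  have h := Complex.norm_le_of_forall_mem_frontier_norm_le (f := fun z => cexp (-p z))
    (U := ball (0 : ℂ) 1) (C := Real.exp (-c)) isBounded_ball
    (Differentiable.diffContOnCl (by fun_prop)) (fun z hz => ?_) (subset_closure hw)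
  · simpa [Complex.norm_exp] using h
  · rw [frontier_ball _ one_ne_zero] at hz
    simpa [Complex.norm_exp] using hc ⟨z, hz⟩

/-- The inclusion of the circle into the plane is an isometry. -/
lemma Circle.isometry_coe : Isometry fun z : Circle => (z : ℂ) :=
  Isometry.of_dist_eq fun _ _ => rfl

lemma DiffContOnCl.continuous_circle {h : ℂ → ℂ} (hh : DiffContOnCl ℂ h (ball 0 1)) :
    Continuous fun z : Circle => h z :=
  hh.continuousOn_ball.comp_continuous Circle.isometry_coe.continuous fun z => by
    simp [Circle.norm_coe z]

section CircleMeasure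

variable [MeasurableSpace Circle] [BorelSpace Circle] {μ : Measure Circle} [IsFiniteMeasure μ]

lemma Continuous.integrable_circle {E : Type*} [NormedAddCommGroup E] {h : Circle → E}
    (hh : Continuous h) : Integrable h μ :=
  hh.integrable_of_hasCompactSupport (HasCompactSupport.of_compactSpace h)

variable [μ.IsMulLeftInvariant]

/-- The mean value property with respect to a rotation-invariant finite measure on the circle. -/
lemma integral_circle_of_diffContOnCl {h : ℂ → ℂ} (hh : DiffContOnCl ℂ h (ball 0 1)) :
    ∫ z : Circle, h z ∂μ = μ.real univ * h 0 := by
  have hcont : Continuous fun z : Circle => h z := hh.continuous_circle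
  have hmean (z : Circle) :
      ∫ θ in 0..2 * Real.pi, h ↑(Circle.exp θ * z) = 2 * Real.pi * h 0 := by
    have hz : DiffContOnCl ℂ (fun w => h (w * z)) (ball 0 |1|) := by
      rw [abs_one]
      refine hh.comp (g := fun w : ℂ => w * z) (Differentiable.diffContOnCl (by fun_prop)) ?_
      intro w hw
      simpa [Circle.norm_coe z] using hw
    have hav := hz.circleAverage
    rw [Real.circleAverage_def, inv_smul_eq_iff₀ (by positivity)] at hav
    simpa [circleMap] using hav
  have hswap : ∫ θ in 0..2 * Real.pi, ∫ z : Circle, h ↑(Circle.exp θ * z) ∂μ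
      = ∫ z : Circle, (∫ θ in 0..2 * Real.pi, h ↑(Circle.exp θ * z)) ∂μ := by
    apply intervalIntegral_integral_swap
    obtain ⟨C, hC⟩ := isCompact_univ.exists_bound_of_continuousOn hcont.continuousOn
    have hunc : Continuous (Function.uncurry fun (θ : ℝ) (z : Circle) => h ↑(Circle.exp θ * z)) :=
      hcont.comp (f := fun x : ℝ × Circle => Circle.exp x.1 * x.2) (by fun_prop)
    have : IsFiniteMeasure (volume.restrict (uIoc 0 (2 * Real.pi))) :=
      ⟨by simp [uIoc]⟩
    exact Integrable.of_bound hunc.aestronglyMeasurable C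
      (ae_of_all _ fun x => hC _ (mem_univ _))
  simp_rw [hmean, integral_mul_left_eq_self (fun z : Circle => h z)] at hswap
  simp only [intervalIntegral.integral_const, sub_zero, integral_const] at hswap
  have hpi : ((2 * Real.pi : ℝ) : ℂ) ≠ 0 := by exact_mod_cast Real.two_pi_pos.ne'
  apply mul_left_cancel₀ hpi
  simp only [Complex.real_smul] at hswap
  rw [hswap]
  push_cast
  ring

/-- A rotation-invariant finite measure does not decrease under the boundary values of a
holomorphic self-map of the disc fixing the origin, tested against continuous functions. -/
lemma measureReal_le_integral_of_tendsto_boundary {f : ℂ → ℂ}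
    (hf : DifferentiableOn ℂ f (ball 0 1)) (hmaps : MapsTo f (ball 0 1) (ball 0 1))
    (hf0 : f 0 = 0) {B K : Set Circle} (hB : MeasurableSet B)
    {F : Circle → Circle} (hF : ContinuousOn F B) (hFK : MapsTo F B K)
    (hlim : ∀ z ∈ B, Tendsto (fun r : ℝ => f (r * z)) (𝓝[<] 1) (𝓝 (F z)))
    (g : C(Circle, ℝ)) (hg0 : 0 ≤ g) (hg1 : ∀ z ∈ K, 1 ≤ g z) :
    μ.real B ≤ ∫ z, g z ∂μ := by
  have key : ∀ ε > 0, μ.real B ≤ ∫ z, g z ∂μ + 2 * ε * μ.real univ := by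
    intro ε hε
    obtain ⟨p, hp, hpg⟩ := exists_entire_re_approx g hε
    have hpos {w : ℂ} (hw : w ∈ ball (0 : ℂ) 1) : 0 ≤ (p w).re + ε := by
      have := le_re_of_forall_circle_le hp (c := -ε)
        (fun z => by linarith [(abs_le.1 (hpg z)).1, show 0 ≤ g z from hg0 z]) hw
      linarith
    have hball {r : ℝ} (hr : r ∈ Ioo (0 : ℝ) 1) {w : ℂ} (hw : ‖w‖ ≤ 1) :
        (r : ℂ) * w ∈ ball (0 : ℂ) 1 := by
      rw [mem_ball_zero_iff, norm_mul, Complex.norm_real, Real.norm_of_nonneg hr.1.le]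
      nlinarith [hr.1, hr.2]
    have hp_int : Integrable (fun z : Circle => (p z).re) μ :=
      Continuous.integrable_circle (by have := hp.continuous; fun_prop)
    have hre {h : ℂ → ℂ} (hh : DiffContOnCl ℂ h (ball 0 1)) :
        ∫ z : Circle, (h z).re ∂μ = μ.real univ * (h 0).re := by
      have hcont : Continuous fun z : Circle => h z := hh.continuous_circle
      have := congrArg Complex.re (integral_circle_of_diffContOnCl (μ := μ) hh)
      rw [Complex.re_ofReal_mul] at this
      rw [← this]
      exact integral_re (𝕜 := ℂ) hcont.integrable_circle
    have hfr {r : ℝ} (hr : r ∈ Ioo (0 : ℝ) 1) :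
        ContinuousOn (fun w => f (r * w)) (closedBall 0 1) :=
      hf.continuousOn.comp (by fun_prop) fun w hw => hball hr (by simpa using hw)
    have hpfr {r : ℝ} (hr : r ∈ Ioo (0 : ℝ) 1) :
        DiffContOnCl ℂ (fun w => p (f (r * w))) (ball 0 1) := by
      refine ⟨hp.comp_differentiableOn (hf.comp (by fun_prop) fun w hw => hball hr ?_), ?_⟩
      · exact (mem_ball_zero_iff.1 hw).le
      · rw [closure_ball _ one_ne_zero]
        exact hp.continuous.comp_continuousOn (hfr hr)
    have hcontr {r : ℝ} (hr : r ∈ Ioo (0 : ℝ) 1) :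
        Continuous fun z : Circle => (p (f (r * z))).re + ε := by
      have : Continuous fun z : Circle => p (f (r * z)) :=
        (hpfr hr).continuous_circle
      exact (Complex.continuous_re.comp this).add continuous_const
    have hev : ∀ᶠ r : ℝ in 𝓝[<] 1, r ∈ Ioo (0 : ℝ) 1 := Ioo_mem_nhdsLT zero_lt_one
    have hle : ∀ᶠ r : ℝ in 𝓝[<] 1, ∫ z in B, ((p (f (r * z))).re + ε) ∂μ
        ≤ ∫ z : Circle, ((p z).re + ε) ∂μ := by
      filter_upwards [hev] with r hr
      refine (setIntegral_le_integral (hcontr hr).integrable_circle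
        (ae_of_all _ fun z => hpos (hmaps (hball hr (Circle.norm_coe z).le)))).trans_eq ?_
      rw [integral_add _ (integrable_const _), integral_add hp_int (integrable_const _),
        hre (hpfr hr), hre hp.diffContOnCl]
      · simp [hf0]
      · exact ((hcontr hr).sub continuous_const).integrable_circle.congr
          (ae_of_all _ fun z => add_sub_cancel_right _ ε)
    obtain ⟨C, hC⟩ := (isCompact_closedBall (0 : ℂ) 1).exists_bound_of_continuousOn
      hp.continuous.continuousOn
    have htend : Tendsto (fun r : ℝ => ∫ z in B, ((p (f (r * z))).re + ε) ∂μ) (𝓝[<] 1)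
        (𝓝 (∫ z in B, ((p (F z)).re + ε) ∂μ)) := by
      refine tendsto_integral_filter_of_dominated_convergence (fun _ => C + ε) ?_ ?_
        (integrable_const _) ?_
      · filter_upwards [hev] with r hr using (hcontr hr).aestronglyMeasurable
      · filter_upwards [hev] with r hr
        refine ae_of_all _ fun z => (norm_add_le _ _).trans ?_
        rw [Real.norm_of_nonneg hε.le]
        gcongr
        exact (Complex.abs_re_le_norm _).trans
          (hC _ (ball_subset_closedBall (hmaps (hball hr (Circle.norm_coe z).le))))
      · refine (ae_restrict_mem hB).mono fun z hz => ?_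
        have : Continuous fun w => (p w).re + ε := by have := hp.continuous; fun_prop
        exact (this.tendsto _).comp (hlim z hz)
    have hlow : μ.real B ≤ ∫ z in B, ((p (F z)).re + ε) ∂μ := by
      have hmeas : AEStronglyMeasurable (fun z => (p (F z)).re + ε) (μ.restrict B) := by
        have : Continuous fun z : Circle => (p z).re + ε := by have := hp.continuous; fun_prop
        exact (this.comp_continuousOn hF).aestronglyMeasurable hB
      have hFint : Integrable (fun z => (p (F z)).re + ε) (μ.restrict B) := by
        refine Integrable.of_bound hmeas (C + ε) (ae_of_all _ fun z => (norm_add_le _ _).trans ?_)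
        rw [Real.norm_of_nonneg hε.le]
        gcongr
        exact (Complex.abs_re_le_norm _).trans (hC _ (by simp [Circle.norm_coe (F z)]))
      calc μ.real B = ∫ _ in B, (1 : ℝ) ∂μ := by simp
        _ ≤ _ := by
          refine setIntegral_mono_on (integrable_const _) hFint hB fun z hz => ?_
          linarith [(abs_le.1 (hpg (F z))).1, hg1 _ (hFK hz)]
    calc μ.real B ≤ _ := hlow
      _ ≤ _ := le_of_tendsto htend hle
      _ ≤ ∫ z, (g z + 2 * ε) ∂μ := by
        refine integral_mono (hp_int.add (integrable_const _))
          (g.continuous.integrable_circle.add (integrable_const _)) fun z => ?_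
        linarith [(abs_le.1 (hpg z)).2]
      _ = _ := by
        rw [integral_add g.continuous.integrable_circle (integrable_const _)]
        simp [mul_comm]
  refine le_of_forall_pos_le_add fun δ hδ => ?_
  have h0 : 0 ≤ μ.real univ := measureReal_nonneg
  refine (key (δ / (2 * (μ.real univ + 1))) (by positivity)).trans ?_
  gcongr
  rw [mul_div_assoc', div_mul_eq_mul_div, div_le_iff₀ (by positivity)]
  nlinarith

/-- A rotation-invariant finite measure does not decrease under the boundary values of a
holomorphic self-map of the disc fixing the origin. -/
lemma measure_le_of_tendsto_boundary {f : ℂ → ℂ}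
    (hf : DifferentiableOn ℂ f (ball 0 1)) (hmaps : MapsTo f (ball 0 1) (ball 0 1))
    (hf0 : f 0 = 0) {B K : Set Circle} (hB : MeasurableSet B) (hK : IsClosed K)
    {F : Circle → Circle} (hF : ContinuousOn F B) (hFK : MapsTo F B K)
    (hlim : ∀ z ∈ B, Tendsto (fun r : ℝ => f (r * z)) (𝓝[<] 1) (𝓝 (F z))) :
    μ B ≤ μ K := by
  have hδ (n : ℕ) : (0 : ℝ) < 1 / (n + 1) := by positivity
  rw [← ENNReal.toReal_le_toReal (measure_ne_top _ _) (measure_ne_top _ _)]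
  refine ge_of_tendsto' (tendsto_integral_thickenedIndicator_of_isClosed μ hK hδ
    tendsto_one_div_add_atTop_nhds_zero_nat) fun n => ?_
  exact measureReal_le_integral_of_tendsto_boundary hf hmaps hf0 hB hF hFK hlim
    ⟨fun z => (thickenedIndicator (hδ n) K z : ℝ), by fun_prop⟩ (fun z => NNReal.coe_nonneg _)
    fun z hz => NNReal.coe_le_coe.2 (thickenedIndicator_one (hδ n) K hz).ge

end CircleMeasure

instance : IsIsometricSMul Circle Circle where
  isometry_smul c := Isometry.of_dist_eq fun x y => by
    rw [← Circle.isometry_coe.dist_eq, ← Circle.isometry_coe.dist_eq]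
    simp [dist_eq_norm, ← mul_sub, Circle.norm_coe c]

instance [MeasurableSpace Circle] [BorelSpace Circle] :
    IsFiniteMeasure (μH[1] : Measure Circle) where
  measure_univ_lt_top := by
    have hlip : LipschitzWith 1 fun θ : ℝ => Circle.exp θ := by
      refine LipschitzWith.of_dist_le_mul fun x y => ?_
      have h := Real.norm_exp_I_mul_ofReal_sub_one_le (x := x - y)
      have hxy : cexp (x * I) - cexp (y * I) = cexp (y * I) * (cexp (I * ↑(x - y)) - 1) := by
        rw [mul_sub, ← Complex.exp_add, mul_one]
        push_cast
        ring_nf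
      rw [← Circle.isometry_coe.dist_eq, NNReal.coe_one, one_mul, Circle.coe_exp, Circle.coe_exp,
        dist_eq_norm, dist_eq_norm, hxy, norm_mul, Complex.norm_exp_ofReal_mul_I, one_mul]
      exact h
    have huniv : (fun θ : ℝ => Circle.exp θ) '' Icc (-Real.pi) Real.pi = univ := by
      refine eq_univ_of_forall fun z => ⟨Complex.arg z, ?_, Circle.exp_arg z⟩
      exact ⟨(Complex.neg_pi_lt_arg _).le, Complex.arg_le_pi _⟩
    rw [← huniv]
    refine (hlip.hausdorffMeasure_image_le zero_le_one _).trans_lt ?_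
    simp [hausdorffMeasure_real]

/-- **Löwner's theorem.**  Let `f` be a holomorphic self-map of the unit disc
fixing the origin, and let `A = {e^{iθ} : θ ∈ [θ₁, θ₂]}` (with `θ₁ < θ₂`) be a
nontrivial closed arc of the unit circle.  If `F` is a continuous extension of
`f` to `D ∪ A` mapping `A` into the unit circle, then the length
(one-dimensional Hausdorff measure) of the image arc `F(A)` is at least the
length of `A`. -/
theorem loewner_boundary_arc_length
    (f : ℂ → ℂ)
    (hf : DifferentiableOn ℂ f (ball (0 : ℂ) 1))
    (hmaps : Set.MapsTo f (ball (0 : ℂ) 1) (ball (0 : ℂ) 1))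
    (hf0 : f 0 = 0)
    (θ₁ θ₂ : ℝ) (hθ : θ₁ < θ₂)
    (A : Set ℂ)
    (hA : A = (fun θ : ℝ => Complex.exp (θ * Complex.I)) '' Icc θ₁ θ₂)
    (F : ℂ → ℂ)
    (hF_cont : ContinuousOn F (ball (0 : ℂ) 1 ∪ A))
    (hF_eq : Set.EqOn F f (ball (0 : ℂ) 1))
    (hFA : F '' A ⊆ sphere (0 : ℂ) 1) :
    μH[1] A ≤ μH[1] (F '' A) := by
  borelize Circle
  have hcoe (s : Set ℂ) (hs : s ⊆ sphere 0 1) :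
      μH[1] ((fun z : Circle => (z : ℂ)) ⁻¹' s) = μH[1] s := by
    rw [Circle.isometry_coe.hausdorffMeasure_preimage (Or.inl zero_le_one), inter_eq_left.2]
    exact fun z hz => ⟨⟨z, hs hz⟩, rfl⟩
  have hA_sphere : A ⊆ sphere 0 1 := by
    rintro _ hz
    obtain ⟨θ, -, rfl⟩ := hA ▸ hz
    simp
  have hA_comp : IsCompact A := by
    rw [hA]
    exact isCompact_Icc.image (by fun_prop)
  have hFA_comp : IsCompact (F '' A) := hA_comp.image_of_continuousOn (hF_cont.mono (by simp))
  rw [← hcoe A hA_sphere, ← hcoe _ hFA]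
  classical
  let G : Circle → Circle := fun z =>
    if hz : (z : ℂ) ∈ A then ⟨F z, hFA (mem_image_of_mem F hz)⟩ else 1
  have hG {z : Circle} (hz : (z : ℂ) ∈ A) : (G z : ℂ) = F z := by simp [G, hz]
  refine measure_le_of_tendsto_boundary hf hmaps hf0
    (hA_comp.isClosed.preimage Circle.isometry_coe.continuous).measurableSet
    (hFA_comp.isClosed.preimage Circle.isometry_coe.continuous) (F := G) ?_ ?_ ?_
  · rw [Circle.isometry_coe.isEmbedding.continuousOn_iff]
    refine ContinuousOn.congr (f := fun z : Circle => F z) ?_ fun z hz => hG hz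
    exact hF_cont.comp Circle.isometry_coe.continuous.continuousOn fun z hz => Or.inr hz
  · intro z hz
    rw [mem_preimage, hG hz]
    exact mem_image_of_mem F hz
  · intro z hz
    rw [hG hz]
    have hball : ∀ᶠ r : ℝ in 𝓝[<] 1, (r * z : ℂ) ∈ ball (0 : ℂ) 1 := by
      filter_upwards [Ioo_mem_nhdsLT zero_lt_one] with r hr
      simpa [abs_of_pos hr.1, Circle.norm_coe z] using hr.2
    have hray : Tendsto (fun r : ℝ => (r * z : ℂ)) (𝓝[<] 1) (𝓝[ball 0 1 ∪ A] z) := by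
      refine tendsto_nhdsWithin_iff.2 ⟨?_, hball.mono fun r hr => Or.inl hr⟩
      refine tendsto_nhdsWithin_of_tendsto_nhds ?_
      have : Continuous fun r : ℝ => (r * z : ℂ) := by fun_prop
      simpa using this.tendsto 1
    exact ((hF_cont z (Or.inr hz)).tendsto.comp hray).congr' (hball.mono fun r hr => hF_eq hr)
end

section
/- (Osserman's boundary Schwarz inequality.) Let f : D → D be holomorphic with f(0) = 0. Suppose b ∈ ∂D is such that f extends continuously to b with |f(b)| = 1 (say f(b) = c), and the angular/radial derivative f'(b) := lim_{r→1⁻} (f(rb) − c)/(rb − b) exists. Then |f'(b)| ≥ 2/(1 + |f'(0)|). -/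
open Complex Metric Set Filter

open scoped ComplexConjugate

lemma norm_one_sub_conj_mul_sq_sub_norm_sub_sq (a w : ℂ) :
    ‖1 - conj a * w‖ ^ 2 - ‖w - a‖ ^ 2 = (1 - ‖a‖ ^ 2) * (1 - ‖w‖ ^ 2) := by
  simp only [Complex.sq_norm, Complex.normSq_apply, Complex.sub_re, Complex.sub_im,
    Complex.mul_re, Complex.mul_im, Complex.conj_re, Complex.conj_im, Complex.one_re,
    Complex.one_im]
  ring

lemma norm_mul_le_of_norm_sub_le {a w : ℂ} {r : ℝ} (ha : ‖a‖ ≤ 1) (hw : ‖w‖ ≤ 1)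
    (hr : 0 ≤ r) (hr1 : r ≤ 1) (h : ‖w - a‖ ≤ r * ‖1 - conj a * w‖) :
    ‖w‖ * (1 + r * ‖a‖) ≤ r + ‖a‖ := by
  have hid := norm_one_sub_conj_mul_sq_sub_norm_sub_sq a w
  have hsq : ‖w - a‖ ^ 2 ≤ r ^ 2 * ‖1 - conj a * w‖ ^ 2 := by
    rw [← mul_pow]
    exact pow_le_pow_left₀ (norm_nonneg _) h 2
  have hlow : (‖w‖ - ‖a‖) ^ 2 ≤ ‖w - a‖ ^ 2 :=
    sq_le_sq.2 (by simpa using abs_norm_sub_norm_le w a)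
  have has : ‖a‖ * ‖w‖ ≤ 1 := mul_le_one₀ ha (norm_nonneg _) hw
  have hmul : (1 - r ^ 2) * (‖w‖ - ‖a‖) ^ 2 ≤ (1 - r ^ 2) * ‖w - a‖ ^ 2 :=
    mul_le_mul_of_nonneg_left hlow (by nlinarith)
  have hfin : (‖w‖ - ‖a‖) ^ 2 ≤ (r * (1 - ‖a‖ * ‖w‖)) ^ 2 := by
    have hQ : ‖1 - conj a * w‖ ^ 2 = ‖w - a‖ ^ 2 + (1 - ‖a‖ ^ 2) * (1 - ‖w‖ ^ 2) := by linarith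
    rw [hQ] at hsq
    linarith
  have := abs_le_of_sq_le_sq hfin (mul_nonneg hr (by linarith))
  linarith [le_abs_self (‖w‖ - ‖a‖)]

/-- The Schwarz-Pick bound at the origin. -/
lemma norm_mul_le_of_mapsTo_closedBall {g : ℂ → ℂ} (hg : DifferentiableOn ℂ g (ball 0 1))
    (hmaps : MapsTo g (ball 0 1) (closedBall 0 1)) {z : ℂ} (hz : ‖z‖ < 1) :
    ‖g z‖ * (1 + ‖z‖ * ‖g 0‖) ≤ ‖z‖ + ‖g 0‖ := by
  have hle : ∀ w ∈ ball (0 : ℂ) 1, ‖g w‖ ≤ 1 := fun w hw => by simpa using hmaps hw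
  have hz' : z ∈ ball (0 : ℂ) 1 := by simpa using hz
  have hα := hle 0 (by simp)
  rcases hα.eq_or_lt with h1 | h1
  · rw [h1]
    nlinarith [hle z hz', norm_nonneg z]
  have hpos : ∀ w ∈ ball (0 : ℂ) 1, 0 < ‖1 - conj (g 0) * g w‖ := fun w hw => by
    have h2 : ‖conj (g 0) * g w‖ < 1 := by
      rw [norm_mul, Complex.norm_conj]
      exact (mul_le_of_le_one_right (norm_nonneg _) (hle w hw)).trans_lt h1
    have h3 := norm_sub_norm_le (1 : ℂ) (conj (g 0) * g w)
    rw [norm_one] at h3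
    linarith
  have hS : ‖(g z - g 0) / (1 - conj (g 0) * g z)‖ ≤ ‖z‖ := by
    refine Complex.norm_le_norm_of_mapsTo_ball (R := 1)
      (f := fun w => (g w - g 0) / (1 - conj (g 0) * g w)) ?_ ?_ (by simp) hz
    · exact (hg.sub_const _).div ((hg.const_mul _).const_sub _)
        fun w hw => norm_pos_iff.1 (hpos w hw)
    · intro w hw
      rw [mem_closedBall_zero_iff, norm_div, div_le_one (hpos w hw)]
      refine le_of_sq_le_sq ?_ (norm_nonneg _)
      have hid := norm_one_sub_conj_mul_sq_sub_norm_sub_sq (g 0) (g w)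
      have : 0 ≤ (1 - ‖g 0‖ ^ 2) * (1 - ‖g w‖ ^ 2) :=
        mul_nonneg (by nlinarith [norm_nonneg (g 0)])
          (by nlinarith [norm_nonneg (g w), hle w hw])
      linarith
  rw [norm_div, div_le_iff₀ (hpos z hz')] at hS
  exact norm_mul_le_of_norm_sub_le hα (hle z hz') (norm_nonneg _) hz.le hS

/-- A Schwarz lemma refined by the value of the derivative at the origin. -/
lemma norm_mul_le_of_mapsTo_ball_of_map_zero {f : ℂ → ℂ}
    (hf : DifferentiableOn ℂ f (ball 0 1)) (hmaps : MapsTo f (ball 0 1) (ball 0 1))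
    (hf0 : f 0 = 0) {z : ℂ} (hz : ‖z‖ < 1) :
    ‖f z‖ * (1 + ‖z‖ * ‖deriv f 0‖) ≤ ‖z‖ * (‖z‖ + ‖deriv f 0‖) := by
  have hg : DifferentiableOn ℂ (dslope f 0) (ball 0 1) :=
    (Complex.differentiableOn_dslope (ball_mem_nhds _ one_pos)).2 hf
  have hgm : MapsTo (dslope f 0) (ball 0 1) (closedBall 0 1) := fun w hw => by
    rw [mem_closedBall_zero_iff]
    simpa using Complex.norm_dslope_le_div_of_mapsTo_ball hf
      (by rw [hf0]; exact hmaps.mono_right ball_subset_closedBall) hw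
  have h := norm_mul_le_of_mapsTo_closedBall hg hgm hz
  rw [dslope_same] at h
  have hfz : f z = z * dslope f 0 z := by
    simpa [hf0] using (sub_smul_dslope f 0 z).symm
  rw [hfz, norm_mul, mul_assoc]
  exact mul_le_mul_of_nonneg_left h (norm_nonneg z)

/-- **Osserman's boundary Schwarz inequality.**  Let `f` be a holomorphic
self-map of the unit disc with `f(0) = 0`.  Suppose `b` is a boundary point at
which `f` extends continuously with boundary value `c` of modulus one, and the
radial derivative `L = lim_{r→1⁻} (f(rb) - c)/(rb - b)` exists.  Then
`|L| ≥ 2/(1 + |f'(0)|)`. -/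
theorem osserman_boundary_schwarz
    (f : ℂ → ℂ)
    (hf : DifferentiableOn ℂ f (ball (0 : ℂ) 1))
    (hmaps : Set.MapsTo f (ball (0 : ℂ) 1) (ball (0 : ℂ) 1))
    (hf0 : f 0 = 0)
    (b c : ℂ) (hb : ‖b‖ = 1) (hc : ‖c‖ = 1)
    (hcont : Tendsto f (nhdsWithin b (ball (0 : ℂ) 1)) (nhds c))
    (L : ℂ)
    (hL : Tendsto (fun r : ℝ => (f ((r : ℂ) * b) - c) / ((r : ℂ) * b - b))
            (nhdsWithin 1 (Iio (1 : ℝ))) (nhds L)) :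
    2 / (1 + ‖deriv f 0‖) ≤ ‖L‖ := by
  set α := ‖deriv f 0‖ with hα
  have hα0 : 0 ≤ α := norm_nonneg _
  have hlim : Tendsto (fun r : ℝ => (1 + r) / (1 + r * α)) (nhdsWithin 1 (Iio (1 : ℝ)))
      (nhds (2 / (1 + α))) := by
    have hc : ContinuousAt (fun r : ℝ => (1 + r) / (1 + r * α)) 1 :=
      ContinuousAt.div (by fun_prop) (by fun_prop) (by positivity)
    have h := hc.tendsto.mono_left (nhdsWithin_le_nhds (s := Iio (1 : ℝ)))
    norm_num at h
    exact h
  refine le_of_tendsto_of_tendsto hlim hL.norm ?_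
  filter_upwards [Ioo_mem_nhdsLT (zero_lt_one (α := ℝ))] with r hr
  have hrb : ‖(r : ℂ) * b‖ = r := by
    rw [norm_mul, hb, mul_one, Complex.norm_of_nonneg hr.1.le]
  have hden : ‖(r : ℂ) * b - b‖ = 1 - r := by
    rw [show (r : ℂ) * b - b = ((r - 1 : ℝ) : ℂ) * b by push_cast; ring, norm_mul, hb, mul_one,
      Complex.norm_real, Real.norm_eq_abs, abs_of_neg (by linarith [hr.2]), neg_sub]
  have hfb := norm_mul_le_of_mapsTo_ball_of_map_zero hf hmaps hf0 (z := r * b)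
    (by rw [hrb]; exact hr.2)
  rw [hrb, ← hα] at hfb
  have hnum : 1 - ‖f (r * b)‖ ≤ ‖f (r * b) - c‖ := by
    rw [← hc, norm_sub_rev]
    exact norm_sub_norm_le c _
  have hpos : 0 < 1 + r * α := by nlinarith [hr.1]
  rw [norm_div, hden, div_le_div_iff₀ hpos (by linarith [hr.2])]
  nlinarith [mul_le_mul_of_nonneg_right hnum hpos.le]
end

section
/- (Sharpness of Osserman's inequality.) For each real a with 0 ≤ a ≤ 1, the function f(ζ) = ζ·(ζ + a)/(1 + aζ) is holomorphic on the open unit disc D, maps D into D, satisfies f(0) = 0 and |f'(0)| = a, extends holomorphically across the boundary point 1 with f(1) = 1, and its derivative at 1 satisfies |f'(1)| = 2/(1 + a). Thus equality holds in the boundary Schwarz inequality |f'(1)| ≥ 2/(1 + |f'(0)|). -/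
open Complex Metric Set

lemma one_add_ofReal_mul_ne_zero {a : ℝ} (ha0 : 0 ≤ a) (ha1 : a ≤ 1) {z : ℂ} (hz : -1 < z.re) :
    1 + (a : ℂ) * z ≠ 0 := by
  intro h
  have hre := congrArg Complex.re h
  simp only [add_re, one_re, re_ofReal_mul, zero_re] at hre
  rcases ha0.eq_or_lt with rfl | ha
  · simp at hre
  · nlinarith [mul_pos ha (neg_lt_iff_pos_add.1 hz)]

lemma norm_add_ofReal_le_norm_one_add_mul {a : ℝ} (ha0 : 0 ≤ a) (ha1 : a ≤ 1) {z : ℂ}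
    (hz : ‖z‖ ≤ 1) : ‖z + (a : ℂ)‖ ≤ ‖1 + (a : ℂ) * z‖ := by
  have hz2 : normSq z ≤ 1 := by
    rw [normSq_eq_norm_sq]
    exact pow_le_one₀ (norm_nonneg z) hz
  rw [← sq_le_sq₀ (norm_nonneg _) (norm_nonneg _), ← normSq_eq_norm_sq, ← normSq_eq_norm_sq]
  rw [normSq_apply] at hz2
  simp only [normSq_apply, add_re, add_im, one_re, one_im, ofReal_re, ofReal_im, re_ofReal_mul,
    im_ofReal_mul]
  nlinarith [mul_nonneg (sub_nonneg.2 (pow_le_one₀ ha0 ha1 : a ^ 2 ≤ 1)) (sub_nonneg.2 hz2)]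

lemma hasDerivAt_mul_add_div_one_add_mul {a z : ℂ} (h : 1 + a * z ≠ 0) :
    HasDerivAt (fun ζ : ℂ => ζ * (ζ + a) / (1 + a * ζ))
      (((2 * z + a) * (1 + a * z) - z * (z + a) * a) / (1 + a * z) ^ 2) z := by
  have hnum := (hasDerivAt_id' z).mul ((hasDerivAt_id' z).add_const a)
  have hden := ((hasDerivAt_id' z).const_mul a).const_add 1
  refine (hnum.div hden h).congr_deriv ?_
  simp only [Pi.mul_apply]
  ring

/-- **Sharpness of Osserman's boundary Schwarz inequality.**  For each real
`a ∈ [0,1]`, the function `f(ζ) = ζ (ζ + a)/(1 + aζ)` is holomorphic on the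
unit disc, maps the disc into itself, satisfies `f(0) = 0` and `|f'(0)| = a`,
is holomorphic in a neighborhood of the boundary point `1` with `f(1) = 1`,
and `|f'(1)| = 2/(1+a)`, so that equality holds in the boundary Schwarz
inequality `|f'(1)| ≥ 2/(1 + |f'(0)|)`. -/
theorem osserman_inequality_sharp (a : ℝ) (ha0 : 0 ≤ a) (ha1 : a ≤ 1) :
    ∀ f : ℂ → ℂ, (f = fun ζ : ℂ => ζ * (ζ + (a : ℂ)) / (1 + (a : ℂ) * ζ)) →
      DifferentiableOn ℂ f (ball (0 : ℂ) 1) ∧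
      Set.MapsTo f (ball (0 : ℂ) 1) (ball (0 : ℂ) 1) ∧
      f 0 = 0 ∧
      ‖deriv f 0‖ = a ∧
      DifferentiableOn ℂ f (ball (1 : ℂ) 1) ∧
      f 1 = 1 ∧
      ‖deriv f 1‖ = 2 / (1 + a) ∧
      ‖deriv f 1‖ = 2 / (1 + ‖deriv f 0‖) := by
  rintro f rfl
  have hderiv : ∀ z : ℂ, -1 < z.re → _ := fun z hz =>
    hasDerivAt_mul_add_div_one_add_mul (one_add_ofReal_mul_ne_zero ha0 ha1 hz)
  have hre : ∀ z ∈ ball (0 : ℂ) 1, -1 < z.re := fun z hz =>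
    (abs_lt.1 ((abs_re_le_norm z).trans_lt (mem_ball_zero_iff.1 hz))).1
  have hre' : ∀ z ∈ ball (1 : ℂ) 1, -1 < z.re := fun z hz => by
    have h := (abs_lt.1 ((abs_re_le_norm (z - 1)).trans_lt (mem_ball_iff_norm.1 hz))).1
    rw [sub_re, one_re] at h
    linarith
  have hpos : 0 < 1 + a := by linarith
  have hne : (1 + a : ℂ) ≠ 0 := by exact_mod_cast hpos.ne'
  have hderiv0 : ‖deriv (fun ζ : ℂ => ζ * (ζ + (a : ℂ)) / (1 + (a : ℂ) * ζ)) 0‖ = a := by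
    rw [(hderiv 0 (by simp)).deriv]
    simp [abs_of_nonneg ha0]
  have hderiv1 : ‖deriv (fun ζ : ℂ => ζ * (ζ + (a : ℂ)) / (1 + (a : ℂ) * ζ)) 1‖
      = 2 / (1 + a) := by
    have hval : ((2 * 1 + (a : ℂ)) * (1 + a * 1) - 1 * (1 + a) * a) / (1 + a * 1) ^ 2
        = ((2 / (1 + a) : ℝ) : ℂ) := by
      push_cast
      rw [mul_one]
      field_simp
      ring
    rw [(hderiv 1 (by norm_num)).deriv, hval, norm_real, Real.norm_of_nonneg (by positivity)]
  refine ⟨fun z hz => (hderiv z (hre z hz)).differentiableAt.differentiableWithinAt,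
    fun z hz => ?_, by simp, hderiv0,
    fun z hz => (hderiv z (hre' z hz)).differentiableAt.differentiableWithinAt,
    by simp [hne], hderiv1, by rw [hderiv0, hderiv1]⟩
  have hz1 : ‖z‖ < 1 := mem_ball_zero_iff.1 hz
  have hden : 0 < ‖1 + (a : ℂ) * z‖ :=
    norm_pos_iff.2 (one_add_ofReal_mul_ne_zero ha0 ha1 (hre z hz))
  rw [mem_ball_zero_iff, norm_div, norm_mul, div_lt_one hden]
  calc ‖z‖ * ‖z + (a : ℂ)‖ ≤ ‖z‖ * ‖1 + (a : ℂ) * z‖ := by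
        gcongr
        exact norm_add_ofReal_le_norm_one_add_mul ha0 ha1 hz1.le
    _ < ‖1 + (a : ℂ) * z‖ := mul_lt_of_lt_one_left hden hz1
end

section
/- (Burns–Krantz boundary Schwarz lemma.) Let φ : D → D be a holomorphic map of the open unit disc D into itself such that φ(ζ) = 1 + (ζ − 1) + O(|ζ − 1|⁴) as ζ → 1 in D; that is, there exist C > 0 and δ > 0 such that |φ(ζ) − ζ| ≤ C·|ζ − 1|⁴ for all ζ ∈ D with |ζ − 1| < δ. Then φ(ζ) = ζ for every ζ ∈ D. -/
open Complex Metric Set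

open scoped Topology ComplexConjugate

/-- The Möbius transformation `w ↦ (w + a) / (1 + conj a * w)`. -/
noncomputable def discShift (a w : ℂ) : ℂ := (w + a) / (1 + conj a * w)

lemma one_add_conj_mul_ne_zero {a w : ℂ} (ha : ‖a‖ < 1) (hw : ‖w‖ < 1) :
    1 + conj a * w ≠ 0 := by
  intro h
  have h1 : conj a * w = -1 := by linear_combination h
  have h2 : ‖a‖ * ‖w‖ = 1 := by simpa using congrArg norm h1
  nlinarith [norm_nonneg a, norm_nonneg w]

lemma norm_sq_one_add_conj_mul_sub (a w : ℂ) :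
    ‖1 + conj a * w‖ ^ 2 - ‖w + a‖ ^ 2 = (1 - ‖a‖ ^ 2) * (1 - ‖w‖ ^ 2) := by
  simp only [Complex.sq_norm, normSq_apply, add_re, add_im, mul_re, mul_im, conj_re, conj_im,
    one_re, one_im]
  ring

lemma one_sub_norm_sq_discShift {a w : ℂ} (ha : ‖a‖ < 1) (hw : ‖w‖ < 1) :
    1 - ‖discShift a w‖ ^ 2 = (1 - ‖a‖ ^ 2) * (1 - ‖w‖ ^ 2) / ‖1 + conj a * w‖ ^ 2 := by
  have h := norm_pos_iff.2 (one_add_conj_mul_ne_zero ha hw)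
  rw [discShift, norm_div, div_pow, ← norm_sq_one_add_conj_mul_sub, sub_div,
    div_self (pow_ne_zero 2 h.ne')]

lemma norm_discShift_lt_one {a w : ℂ} (ha : ‖a‖ < 1) (hw : ‖w‖ < 1) :
    ‖discShift a w‖ < 1 := by
  have h := norm_pos_iff.2 (one_add_conj_mul_ne_zero ha hw)
  have ha' : 0 < 1 - ‖a‖ ^ 2 := by nlinarith [norm_nonneg a]
  have hw' : 0 < 1 - ‖w‖ ^ 2 := by nlinarith [norm_nonneg w]
  have hpos : 0 < 1 - ‖discShift a w‖ ^ 2 := by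
    rw [one_sub_norm_sq_discShift ha hw]
    positivity
  nlinarith [norm_nonneg (discShift a w)]

lemma differentiableOn_discShift {a : ℂ} (ha : ‖a‖ < 1) :
    DifferentiableOn ℂ (discShift a) (ball 0 1) := by
  unfold discShift
  refine DifferentiableOn.div (by fun_prop) (by fun_prop) fun w hw ↦ ?_
  exact one_add_conj_mul_ne_zero ha (by simpa using hw)

lemma discShift_discShift_neg {a z : ℂ} (ha : ‖a‖ < 1) (hz : ‖z‖ < 1) :
    discShift a (discShift (-a) z) = z := by
  have h1 : 1 + conj (-a) * z ≠ 0 := one_add_conj_mul_ne_zero (by simpa using ha) hz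
  have h2 : 1 + conj a * discShift (-a) z ≠ 0 :=
    one_add_conj_mul_ne_zero ha (norm_discShift_lt_one (by simpa using ha) hz)
  have h3 : discShift (-a) z * (1 + conj (-a) * z) = z + -a := div_mul_cancel₀ _ h1
  rw [discShift, div_eq_iff h2]
  rw [map_neg] at h3
  linear_combination h3

/-- The **Schwarz–Pick lemma**. -/
lemma norm_discShift_neg_le {φ : ℂ → ℂ} (hφ : DifferentiableOn ℂ φ (ball 0 1))
    (hmaps : MapsTo φ (ball 0 1) (ball 0 1)) {a z : ℂ} (ha : ‖a‖ < 1) (hz : ‖z‖ < 1) :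
    ‖discShift (-φ a) (φ z)‖ ≤ ‖discShift (-a) z‖ := by
  have hφn : ∀ {w : ℂ}, ‖w‖ < 1 → ‖φ w‖ < 1 := fun {w} hw ↦ by
    simpa using hmaps (mem_ball_zero_iff.2 hw)
  have hφa : ‖-φ a‖ < 1 := by simpa using hφn ha
  have hshift : MapsTo (discShift a) (ball 0 1) (ball 0 1) := fun w hw ↦
    mem_ball_zero_iff.2 (norm_discShift_lt_one ha (mem_ball_zero_iff.1 hw))
  have hd : DifferentiableOn ℂ (discShift (-φ a) ∘ φ ∘ discShift a) (ball 0 1) :=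
    (differentiableOn_discShift hφa).comp (hφ.comp (differentiableOn_discShift ha) hshift)
      (hmaps.comp hshift)
  have hm : MapsTo (discShift (-φ a) ∘ φ ∘ discShift a) (ball 0 1) (closedBall 0 1) :=
    fun w hw ↦ mem_closedBall_zero_iff.2
      (norm_discShift_lt_one hφa (mem_ball_zero_iff.1 (hmaps (hshift hw)))).le
  have h := norm_le_norm_of_mapsTo_ball hd hm (by simp [discShift])
    (norm_discShift_lt_one (a := -a) (by simpa using ha) hz)
  simpa [discShift_discShift_neg ha hz] using h

lemma schwarz_pick_mul {φ : ℂ → ℂ} (hφ : DifferentiableOn ℂ φ (ball 0 1))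
    (hmaps : MapsTo φ (ball 0 1) (ball 0 1)) {a z : ℂ} (ha : ‖a‖ < 1) (hz : ‖z‖ < 1) :
    (1 - ‖a‖ ^ 2) * (1 - ‖z‖ ^ 2) * ‖1 - conj (φ a) * φ z‖ ^ 2 ≤
      (1 - ‖φ a‖ ^ 2) * (1 - ‖φ z‖ ^ 2) * ‖1 - conj a * z‖ ^ 2 := by
  have hφn : ∀ {w : ℂ}, ‖w‖ < 1 → ‖φ w‖ < 1 := fun {w} hw ↦ by
    simpa using hmaps (mem_ball_zero_iff.2 hw)
  have ha' : ‖-a‖ < 1 := by simpa using ha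
  have hφa : ‖-φ a‖ < 1 := by simpa using hφn ha
  have h1 := norm_pos_iff.2 (one_add_conj_mul_ne_zero ha' hz)
  have h2 := norm_pos_iff.2 (one_add_conj_mul_ne_zero hφa (hφn hz))
  have h : 1 - ‖discShift (-a) z‖ ^ 2 ≤ 1 - ‖discShift (-φ a) (φ z)‖ ^ 2 := by
    gcongr
    exact norm_discShift_neg_le hφ hmaps ha hz
  rw [one_sub_norm_sq_discShift ha' hz, one_sub_norm_sq_discShift hφa (hφn hz),
    div_le_div_iff₀ (by positivity) (by positivity)] at h
  simpa [← sub_eq_add_neg] using h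

lemma re_one_add_div_one_sub (w : ℂ) :
    ((1 + w) / (1 - w)).re = (1 - ‖w‖ ^ 2) / ‖1 - w‖ ^ 2 := by
  rw [div_re, ← add_div, Complex.sq_norm, Complex.sq_norm]
  congr 1
  simp only [normSq_apply, add_re, add_im, sub_re, sub_im, one_re, one_im]
  ring

/-- A special case of **Julia's lemma**, for a self-map of the disc which is tangent to the
identity along the radius ending at `1`. -/
lemma re_one_add_div_one_sub_le {φ : ℂ → ℂ} (hφ : DifferentiableOn ℂ φ (ball 0 1))
    (hmaps : MapsTo φ (ball 0 1) (ball 0 1)) {C δ : ℝ} (hδ : 0 < δ)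
    (hO : ∀ t : ℝ, 0 < t → t < 1 → t < δ → ‖φ (1 - t) - (1 - t)‖ ≤ C * t ^ 4)
    {z : ℂ} (hz : ‖z‖ < 1) :
    ((1 + z) / (1 - z)).re ≤ ((1 + φ z) / (1 - φ z)).re := by
  have hφz : ‖φ z‖ < 1 := by simpa using hmaps (mem_ball_zero_iff.2 hz)
  have hne : ∀ {w : ℂ}, ‖w‖ < 1 → 1 - w ≠ 0 := fun {w} hw h ↦ by
    rw [← sub_eq_zero.1 h] at hw
    simp at hw
  have hsmall : ∀ᶠ t : ℝ in 𝓝[>] 0, 0 < t ∧ t < 1 ∧ t < δ := by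
    filter_upwards [Ioo_mem_nhdsGT (lt_min one_pos hδ)] with t ht
    exact ⟨ht.1, (lt_min_iff.1 ht.2).1, (lt_min_iff.1 ht.2).2⟩
  have hid : Filter.Tendsto (fun t : ℝ ↦ t) (𝓝[>] 0) (𝓝 0) :=
    Filter.tendsto_id.mono_left nhdsWithin_le_nhds
  have hlin : Filter.Tendsto (fun t : ℝ ↦ (1 - t : ℂ)) (𝓝[>] 0) (𝓝 1) := by
    have h : Continuous fun t : ℝ ↦ (1 - t : ℂ) := by fun_prop
    simpa [Function.comp_def] using (h.tendsto 0).comp hid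
  have hφlim : Filter.Tendsto (fun t : ℝ ↦ φ (1 - t)) (𝓝[>] 0) (𝓝 1) := by
    have h0 : Filter.Tendsto (fun t : ℝ ↦ φ (1 - t) - (1 - t)) (𝓝[>] 0) (𝓝 0) := by
      refine squeeze_zero_norm' (a := fun t ↦ C * t ^ 4) ?_ ?_
      · filter_upwards [hsmall] with t ht using hO t ht.1 ht.2.1 ht.2.2
      · simpa using (hid.pow 4).const_mul C
    simpa using h0.add hlin
  have hL : Filter.Tendsto
      (fun t : ℝ ↦ (2 - t) * (1 - ‖z‖ ^ 2) * ‖1 - conj (φ (1 - t)) * φ z‖ ^ 2) (𝓝[>] 0)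
      (𝓝 (2 * (1 - ‖z‖ ^ 2) * ‖1 - φ z‖ ^ 2)) := by
    have h1 : Filter.Tendsto (fun t : ℝ ↦ conj (φ (1 - t))) (𝓝[>] 0) (𝓝 1) := by
      simpa [Function.comp_def] using (continuous_conj.tendsto 1).comp hφlim
    simpa using ((hid.const_sub 2).mul_const (1 - ‖z‖ ^ 2)).mul
      (((h1.mul_const (φ z)).const_sub 1).norm.pow 2)
  have hR : Filter.Tendsto
      (fun t : ℝ ↦ 2 * (1 + C * t ^ 3) * (1 - ‖φ z‖ ^ 2) * ‖1 - (1 - t : ℂ) * z‖ ^ 2) (𝓝[>] 0)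
      (𝓝 (2 * (1 - ‖φ z‖ ^ 2) * ‖1 - z‖ ^ 2)) := by
    simpa using (((((hid.pow 3).const_mul C).const_add 1).const_mul 2).mul_const
      (1 - ‖φ z‖ ^ 2)).mul (((hlin.mul_const z).const_sub 1).norm.pow 2)
  have hle := le_of_tendsto_of_tendsto hL hR (by
    filter_upwards [hsmall] with t ⟨ht0, ht1, htδ⟩
    have hnorm : ‖(1 - t : ℂ)‖ = 1 - t := by
      rw [← ofReal_one, ← ofReal_sub, norm_real, Real.norm_of_nonneg (by linarith)]
    have hr : ‖(1 - t : ℂ)‖ < 1 := by linarith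
    have hφr : ‖φ (1 - t)‖ < 1 := by simpa using hmaps (mem_ball_zero_iff.2 hr)
    have hconj : conj (1 - t : ℂ) = 1 - t := by simp
    have hSP := schwarz_pick_mul hφ hmaps hr hz
    rw [hconj, hnorm] at hSP
    have hlow : 1 - ‖φ (1 - t)‖ ^ 2 ≤ t * (2 * (1 + C * t ^ 3)) := by
      have h1 := norm_sub_norm_le (1 - t : ℂ) (φ (1 - t))
      rw [hnorm, norm_sub_rev] at h1
      nlinarith [hO t ht0 ht1 htδ, norm_nonneg (φ (1 - t))]
    have hφz' : 0 ≤ 1 - ‖φ z‖ ^ 2 := by nlinarith [norm_nonneg (φ z)]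
    have h2 := mul_le_mul_of_nonneg_right hlow
      (mul_nonneg hφz' (sq_nonneg ‖1 - (1 - t : ℂ) * z‖))
    refine le_of_mul_le_mul_left ?_ ht0
    linarith)
  rw [re_one_add_div_one_sub, re_one_add_div_one_sub]
  have h1 := norm_pos_iff.2 (hne hz)
  have h2 := norm_pos_iff.2 (hne hφz)
  rw [div_le_div_iff₀ (by positivity) (by positivity)]
  linarith

/-- A boundary uniqueness principle: a holomorphic function on the disc with nonnegative real part
which is `O((1 - r) ^ 2)` along the radius ending at `1` vanishes identically. -/
lemma eqOn_zero_of_re_nonneg_of_norm_le_sq {F : ℂ → ℂ} (hF : DifferentiableOn ℂ F (ball 0 1))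
    (hre : ∀ z ∈ ball (0 : ℂ) 1, 0 ≤ (F z).re) {B : ℝ}
    (hB : ∀ᶠ t : ℝ in 𝓝[>] 0, ‖F (1 - t)‖ ≤ B * t ^ 2) :
    ∀ z ∈ ball (0 : ℂ) 1, F z = 0 := by
  have hid : Filter.Tendsto (fun t : ℝ ↦ t) (𝓝[>] 0) (𝓝 0) :=
    Filter.tendsto_id.mono_left nhdsWithin_le_nhds
  have hnorm : ∀ {t : ℝ}, t < 1 → ‖(1 - t : ℂ)‖ = 1 - t := fun {t} ht ↦ by
    rw [← ofReal_one, ← ofReal_sub, norm_real, Real.norm_of_nonneg (by linarith)]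
  have hsmall : ∀ᶠ t : ℝ in 𝓝[>] 0, t ∈ Ioo (0 : ℝ) 1 := Ioo_mem_nhdsGT one_pos
  have hmem : ∀ {t : ℝ}, t ∈ Ioo (0 : ℝ) 1 → (1 - t : ℂ) ∈ ball (0 : ℂ) 1 := fun {t} ht ↦ by
    rw [mem_ball_zero_iff, hnorm ht.2]
    linarith [ht.1]
  rcases (hF.analyticOnNhd isOpen_ball).is_constant_or_isOpen
    (convex_ball (0 : ℂ) 1).isPreconnected with ⟨w, hw⟩ | hopen
  · have hw0 : ‖w‖ ≤ 0 := by
      refine ge_of_tendsto (f := fun t : ℝ ↦ B * t ^ 2) (b := ‖w‖) (x := 𝓝[>] (0 : ℝ)) ?_ ?_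
      · simpa using (hid.pow 2).const_mul B
      · filter_upwards [hsmall, hB] with t ht htB
        rwa [hw _ (hmem ht)] at htB
    intro z hz
    rw [hw z hz, norm_le_zero_iff.1 hw0]
  · exfalso
    have hpos : ∀ z ∈ ball (0 : ℂ) 1, 0 < (F z).re := by
      have hsub : F '' ball 0 1 ⊆ interior {w : ℂ | 0 ≤ w.re} :=
        interior_maximal (by rintro _ ⟨z, hz, rfl⟩; exact hre z hz)
          (hopen _ subset_rfl isOpen_ball)
      rw [interior_setOfPred_le_re] at hsub
      exact fun z hz ↦ hsub ⟨z, hz, rfl⟩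
    have hne : ∀ z ∈ ball (0 : ℂ) 1, F z ≠ 0 := fun z hz h ↦ by simpa [h] using hpos z hz
    set K : ℝ := 2 + 2 * ‖(F 0)⁻¹‖
    have hlow : ∀ {t : ℝ}, t ∈ Ioo (0 : ℝ) 1 → t ≤ K * ‖F (1 - t)‖ := fun {t} ht ↦ by
      have h := borelCaratheodory (f := fun z ↦ -(F z)⁻¹) one_pos (hF.inv hne).neg
        (fun z hz ↦ by
          have h1 := div_nonneg (hpos z hz).le (normSq_nonneg (F z))
          have h2 : (-(F z)⁻¹).re = -((F z).re / normSq (F z)) := by simp [inv_re]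
          change (-(F z)⁻¹).re ≤ 1
          linarith) one_pos (hmem ht)
      have hFt := norm_pos_iff.2 (hne _ (hmem ht))
      rw [norm_neg, norm_neg, hnorm ht.2, sub_sub_cancel, ← add_div, norm_inv (F (1 - t)),
        inv_le_iff_one_le_mul₀ hFt, div_mul_eq_mul_div, one_le_div ht.1] at h
      refine h.trans (mul_le_mul_of_nonneg_right ?_ hFt.le)
      nlinarith [norm_nonneg (F 0)⁻¹, ht.1]
    have hone : (1 : ℝ) ≤ 0 := by
      refine ge_of_tendsto (f := fun t : ℝ ↦ K * B * t) (b := 1) (x := 𝓝[>] (0 : ℝ)) ?_ ?_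
      · simpa using hid.const_mul (K * B)
      · filter_upwards [hsmall, hB] with t ht htB
        have hK0 : 0 ≤ K := by positivity
        have h1 := (hlow ht).trans (mul_le_mul_of_nonneg_left htB hK0)
        refine le_of_mul_le_mul_right ?_ ht.1
        linarith
    linarith

/-- **Burns–Krantz boundary Schwarz lemma.**  Let `φ` be a holomorphic self-map
of the unit disc such that `φ(ζ) = 1 + (ζ - 1) + O(|ζ - 1|⁴)` as `ζ → 1`, i.e.
there are `C > 0` and `δ > 0` with `|φ(ζ) - ζ| ≤ C |ζ - 1|⁴` for all `ζ` in the
disc with `|ζ - 1| < δ`.  Then `φ` is the identity on the disc. -/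
theorem burns_krantz
    (φ : ℂ → ℂ)
    (hφ : DifferentiableOn ℂ φ (ball (0 : ℂ) 1))
    (hmaps : Set.MapsTo φ (ball (0 : ℂ) 1) (ball (0 : ℂ) 1))
    (C δ : ℝ) (hC : 0 < C) (hδ : 0 < δ)
    (hO : ∀ ζ ∈ ball (0 : ℂ) 1, ‖ζ - 1‖ < δ → ‖φ ζ - ζ‖ ≤ C * ‖ζ - 1‖ ^ 4) :
    ∀ ζ ∈ ball (0 : ℂ) 1, φ ζ = ζ := by
  have hne : ∀ {w : ℂ}, w ∈ ball (0 : ℂ) 1 → 1 - w ≠ 0 := fun {w} hw h ↦ by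
    rw [← sub_eq_zero.1 h] at hw
    simp at hw
  have hmem : ∀ {t : ℝ}, 0 < t → t < 1 → (1 - t : ℂ) ∈ ball (0 : ℂ) 1 := fun {t} ht0 ht1 ↦ by
    rw [mem_ball_zero_iff, ← ofReal_one, ← ofReal_sub, norm_real,
      Real.norm_of_nonneg (by linarith)]
    linarith
  have hrad : ∀ t : ℝ, 0 < t → t < 1 → t < δ → ‖φ (1 - t) - (1 - t)‖ ≤ C * t ^ 4 := by
    intro t ht0 ht1 htδ
    have h : ‖(1 - t : ℂ) - 1‖ = t := by simp [abs_of_pos ht0]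
    simpa only [h] using hO (1 - t) (hmem ht0 ht1) (by rwa [h])
  have hsub : ∀ {ζ : ℂ}, ζ ∈ ball (0 : ℂ) 1 →
      (1 + φ ζ) / (1 - φ ζ) - (1 + ζ) / (1 - ζ) = 2 * (φ ζ - ζ) / ((1 - φ ζ) * (1 - ζ)) :=
    fun {ζ} hζ ↦ by
      have h1 := hne hζ
      have h2 := hne (hmaps hζ)
      field_simp
      ring
  have hzero := eqOn_zero_of_re_nonneg_of_norm_le_sq
    (F := fun ζ ↦ (1 + φ ζ) / (1 - φ ζ) - (1 + ζ) / (1 - ζ)) (B := 4 * C)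
    (((hφ.const_add 1).div (hφ.const_sub 1) fun ζ hζ ↦ hne (hmaps hζ)).sub
      (DifferentiableOn.div (by fun_prop) (by fun_prop) fun ζ hζ ↦ hne hζ))
    (fun ζ hζ ↦ by
      rw [sub_re, sub_nonneg]
      exact re_one_add_div_one_sub_le hφ hmaps hδ hrad (mem_ball_zero_iff.1 hζ))
    (by
      filter_upwards [Ioo_mem_nhdsGT (lt_min (lt_min one_pos hδ)
        (by positivity : 0 < 1 / (2 * C)))] with t ht
      obtain ⟨ht0, ht⟩ := ht
      obtain ⟨⟨ht1, htδ⟩, htC⟩ := by simpa only [lt_min_iff] using ht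
      rw [lt_div_iff₀ (by positivity)] at htC
      have hφt := hrad t ht0 ht1 htδ
      have hCt : C * t ^ 4 ≤ t / 2 := by
        have h3 : t ^ 3 ≤ t := by nlinarith [mul_pos ht0 ht0]
        nlinarith [mul_le_mul_of_nonneg_left h3 (mul_pos hC ht0).le]
      have hden : t / 2 ≤ ‖1 - φ (1 - t)‖ := by
        have h1 := norm_sub_norm_le (t : ℂ) (φ (1 - t) - (1 - t))
        rw [norm_real, Real.norm_of_nonneg ht0.le,
          show (t : ℂ) - (φ (1 - t) - (1 - t)) = 1 - φ (1 - t) by ring] at h1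
        linarith
      rw [hsub (hmem ht0 ht1), norm_div, norm_mul, norm_mul, sub_sub_cancel, norm_real,
        Real.norm_of_nonneg ht0.le, norm_ofNat,
        div_le_iff₀ (mul_pos (by linarith) ht0)]
      have h4 := mul_le_mul_of_nonneg_left hden (by positivity : 0 ≤ 4 * C * t ^ 3)
      linarith)
  intro ζ hζ
  have h := hzero ζ hζ
  simp only [hsub hζ] at h
  rw [div_eq_zero_iff, or_iff_left (mul_ne_zero (hne (hmaps hζ)) (hne hζ))] at h
  simpa [sub_eq_zero] using h
end

section
/- (Sharpness of the Burns–Krantz theorem.) The function φ(ζ) = ζ − (1/10)·(ζ − 1)³ maps the open unit disc D holomorphically into D, satisfies φ(ζ) − ζ = O(|ζ − 1|³) as ζ → 1, and yet φ is not the identity map. Hence the exponent 4 in the Burns–Krantz theorem cannot be replaced by 3. -/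
open Complex Metric Set

/-- The inequality behind the mapping property, where `t = 1 - re ζ` and `d = 1 - ‖ζ‖ ^ 2`. -/
theorem cubic_perturbation_defect_pos {t d : ℝ} (hd : 0 < d) (hd1 : d ≤ 1) (ht : 0 < t)
    (ht2 : t < 2) (hdt : t ^ 2 + d ≤ 2 * t) :
    0 < d + (1 / 5) * (2 * t ^ 2 + t * d - 2 * t ^ 2 * d - d ^ 2) - (2 * t - d) ^ 3 / 100 := by
  have hs : 0 ≤ 2 * t - d := by nlinarith [sq_nonneg t]
  have hcube : (2 * t - d) ^ 3 ≤ 4 * (2 * t - d) ^ 2 := by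
    nlinarith [mul_nonneg (sq_nonneg (2 * t - d)) (show 0 ≤ 4 - (2 * t - d) by linarith)]
  have hsq : (2 * t - d) ^ 2 ≤ 4 * t ^ 2 := by
    nlinarith [mul_nonneg hs hd.le, mul_pos ht hd]
  have htsq : t ^ 2 < 4 := by nlinarith
  have hdd : d ^ 2 ≤ d := by nlinarith
  have hleft : 0 ≤ (1 - d) * t ^ 2 := mul_nonneg (by linarith) (sq_nonneg t)
  have hright : 0 < d * (20 - 4 * t ^ 2) := mul_pos hd (by linarith)
  nlinarith [mul_pos ht hd]

theorem norm_sub_cubic_lt_one {ζ : ℂ} (hζ : ‖ζ‖ < 1) :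
    ‖ζ - (1 / 10 : ℂ) * (ζ - 1) ^ 3‖ < 1 := by
  have hsq : ζ.re ^ 2 + ζ.im ^ 2 < 1 := by
    have h := Complex.sq_norm ζ
    rw [Complex.normSq_apply] at h
    nlinarith [norm_nonneg ζ]
  have hx := (Complex.abs_re_le_norm ζ).trans_lt hζ
  rw [abs_lt] at hx
  have key := cubic_perturbation_defect_pos (t := 1 - ζ.re) (d := 1 - ζ.re ^ 2 - ζ.im ^ 2)
    (by linarith) (by nlinarith [sq_nonneg ζ.re, sq_nonneg ζ.im]) (by linarith) (by linarith)
    (by nlinarith [sq_nonneg ζ.im])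
  have hre : (ζ - (1 / 10 : ℂ) * (ζ - 1) ^ 3).re =
      ζ.re - (1 / 10) * ((ζ.re - 1) ^ 3 - 3 * (ζ.re - 1) * ζ.im ^ 2) := by
    norm_num [pow_succ, Complex.mul_re, Complex.mul_im]
    ring
  have him : (ζ - (1 / 10 : ℂ) * (ζ - 1) ^ 3).im =
      ζ.im - (1 / 10) * (3 * (ζ.re - 1) ^ 2 * ζ.im - ζ.im ^ 3) := by
    norm_num [pow_succ, Complex.mul_re, Complex.mul_im]
    ring
  rw [← sq_lt_one_iff₀ (norm_nonneg _), Complex.sq_norm, Complex.normSq_apply, hre, him]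
  linarith

/-- **Sharpness of the Burns–Krantz theorem.**  The function
`φ(ζ) = ζ - (1/10)(ζ - 1)³` is a holomorphic self-map of the unit disc with
`φ(ζ) - ζ = O(|ζ - 1|³)` as `ζ → 1`, yet `φ` is not the identity; hence the
exponent `4` in the Burns–Krantz theorem cannot be replaced by `3`. -/
theorem burns_krantz_sharp :
    ∀ φ : ℂ → ℂ, (φ = fun ζ : ℂ => ζ - (1 / 10 : ℂ) * (ζ - 1) ^ 3) →
      DifferentiableOn ℂ φ (ball (0 : ℂ) 1) ∧
      Set.MapsTo φ (ball (0 : ℂ) 1) (ball (0 : ℂ) 1) ∧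
      (∃ C > (0 : ℝ), ∃ δ > (0 : ℝ), ∀ ζ ∈ ball (0 : ℂ) 1,
        ‖ζ - 1‖ < δ → ‖φ ζ - ζ‖ ≤ C * ‖ζ - 1‖ ^ 3) ∧
      ¬(∀ ζ ∈ ball (0 : ℂ) 1, φ ζ = ζ) := by
  rintro φ rfl
  refine ⟨by fun_prop, fun ζ hζ => ?_, ⟨1, one_pos, 1, one_pos, fun ζ _ _ => ?_⟩, fun h => ?_⟩
  · rw [mem_ball_zero_iff] at hζ ⊢
    exact norm_sub_cubic_lt_one hζ
  · have hsub : ζ - (1 / 10 : ℂ) * (ζ - 1) ^ 3 - ζ = -((1 / 10 : ℂ) * (ζ - 1) ^ 3) := by ring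
    simp only [hsub, norm_neg, norm_mul, norm_pow]
    gcongr
    norm_num
  · have h0 := h 0 (by simp)
    norm_num at h0
end

section
/- (H. Cartan's uniqueness theorem.) Let Ω ⊆ ℂⁿ be a bounded, connected open set and fix a point P ∈ Ω. Suppose φ : Ω → Ω is a holomorphic mapping with φ(P) = P whose complex derivative (Jacobian) at P is the identity linear map on ℂⁿ. Then φ is the identity mapping: φ(z) = z for all z ∈ Ω. -/
open Set

open Metric Filter Topology Asymptotics

section NormedSpace

variable {E F : Type*} [NormedAddCommGroup E] [NormedSpace ℂ E]
  [NormedAddCommGroup F] [NormedSpace ℂ F]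

/-- A bounded holomorphic function on a ball that vanishes to infinite order at the center
vanishes identically on the ball. -/
theorem eqOn_zero_ball_of_forall_isLittleO {f : E → F} {c : E} {r M : ℝ}
    (hd : DifferentiableOn ℂ f (ball c r)) (hM : ∀ z ∈ ball c r, ‖f z‖ ≤ M)
    (h₀ : f c = 0) (ho : ∀ k : ℕ, f =o[𝓝 c] fun w ↦ ‖w - c‖ ^ k) :
    EqOn f 0 (ball c r) := by
  intro z hz
  have hr : 0 < r := nonempty_ball.1 ⟨z, hz⟩
  have hbound (k : ℕ) : ‖f z‖ ≤ M * (dist z c / r) ^ (k + 1) := by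
    have := Complex.dist_le_mul_div_pow_of_mapsTo_ball_of_isLittleO (R₂ := M) (n := k) hd
      (fun w hw ↦ by simpa [h₀] using hM w hw) (by simpa [h₀] using ho k) hz
    simpa [h₀] using this
  have hlt : dist z c / r < 1 := (div_lt_one hr).2 hz
  have hlim : Tendsto (fun k : ℕ ↦ M * (dist z c / r) ^ (k + 1)) atTop (𝓝 (M * 0)) :=
    ((tendsto_pow_atTop_nhds_zero_of_lt_one (by positivity) hlt).comp
      (tendsto_add_atTop_nat 1)).const_mul M
  have : ‖f z‖ ≤ M * 0 := ge_of_tendsto' hlim hbound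
  simpa using this

/-- The identity principle for complex differentiable functions on a preconnected open subset
of a complex normed space. -/
theorem DifferentiableOn.eqOn_zero_of_preconnected_of_eventuallyEq {f : E → F} {U : Set E}
    (hd : DifferentiableOn ℂ f U) (hU : IsOpen U) (hc : IsPreconnected U) {c : E} (hcU : c ∈ U)
    (hf : f =ᶠ[𝓝 c] 0) : EqOn f 0 U := by
  have hsub : U ⊆ {z | f =ᶠ[𝓝 z] 0} := by
    refine hc.subset_of_closure_inter_subset isOpen_setOfPred_eventually_nhds ⟨c, hcU, hf⟩ ?_
    rintro z ⟨hz, hzU⟩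
    have hbdd : ∀ᶠ w in 𝓝 z, ‖f w‖ < ‖f z‖ + 1 :=
      (hd.continuousOn.continuousAt (hU.mem_nhds hzU)).norm.eventually_lt_const (lt_add_one _)
    obtain ⟨r, hr, hball⟩ := Metric.eventually_nhds_iff_ball.1 (hbdd.and (hU.eventually_mem hzU))
    obtain ⟨w, hw, hwz⟩ := Metric.mem_closure_iff.1 hz (r / 2) (half_pos hr)
    have hsubset : ball w (r / 2) ⊆ ball z r :=
      ball_subset_ball' (by rw [dist_comm w z]; linarith)
    have hzero : EqOn f 0 (ball w (r / 2)) :=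
      eqOn_zero_ball_of_forall_isLittleO (M := ‖f z‖ + 1)
        (hd.mono fun x hx ↦ (hball x (hsubset hx)).2)
        (fun x hx ↦ (hball x (hsubset hx)).1.le) hw.self_of_nhds
        fun k ↦ (isLittleO_zero _ _).congr' hw.symm EventuallyEq.rfl
    exact hzero.eventuallyEq_of_mem (isOpen_ball.mem_nhds hwz)
  exact fun z hz ↦ (hsub hz).self_of_nhds

/-- A holomorphic function of size `O(‖z - c‖ ^ m)` changes only by `o(‖z - c‖ ^ m)` under
precomposition with a map tangent to the identity at `c`. -/
theorem isLittleO_comp_sub_self {h : E → F} {ψ : E → E} {c : E} {m : ℕ}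
    (hd : ∀ᶠ z in 𝓝 c, DifferentiableAt ℂ h z)
    (hO : h =O[𝓝 c] fun z ↦ ‖z - c‖ ^ m)
    (hψ : (fun z ↦ ψ z - z) =o[𝓝 c] fun z ↦ z - c) :
    (fun z ↦ h (ψ z) - h z) =o[𝓝 c] fun z ↦ ‖z - c‖ ^ m := by
  obtain ⟨C, hC, hbound⟩ := hO.exists_pos
  obtain ⟨δ, hδ, hball⟩ := Metric.eventually_nhds_iff_ball.1 (hbound.bound.and hd)
  have hK : 0 < C * (2 ^ m + 1) := by positivity
  rw [isLittleO_iff]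
  intro ε hε
  have hη : 0 < min (1 / 2) (ε / (C * (2 ^ m + 1))) := by positivity
  filter_upwards [isLittleO_iff.1 hψ hη, ball_mem_nhds c (half_pos hδ)] with z hz hzδ
  rw [mem_ball_iff_norm] at hzδ
  rcases eq_or_ne z c with rfl | hne
  · have : ψ z = z := by simpa [sub_eq_zero] using hz
    simp only [this, sub_self, norm_zero]
    positivity
  have hpos : 0 < ‖z - c‖ := norm_pos_iff.2 (sub_ne_zero.2 hne)
  have hz₁ : ‖ψ z - z‖ ≤ 1 / 2 * ‖z - c‖ := hz.trans (by gcongr; exact min_le_left _ _)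
  have hz₂ : ‖ψ z - z‖ ≤ ε / (C * (2 ^ m + 1)) * ‖z - c‖ :=
    hz.trans (by gcongr; exact min_le_right _ _)
  have hnorm {w : E} (hw : w ∈ ball z ‖z - c‖) : ‖w - c‖ ≤ 2 * ‖z - c‖ := by
    rw [mem_ball_iff_norm] at hw
    linarith [norm_sub_le_norm_sub_add_norm_sub w z c]
  have hmem {w : E} (hw : w ∈ ball z ‖z - c‖) : w ∈ ball c δ := by
    rw [mem_ball_iff_norm]
    linarith [hnorm hw]
  have hsize {w : E} (hw : w ∈ ball c δ) : ‖h w‖ ≤ C * ‖w - c‖ ^ m := by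
    simpa using (hball w hw).1
  have hmaps : MapsTo h (ball z ‖z - c‖)
      (closedBall (h z) (C * (2 ^ m + 1) * ‖z - c‖ ^ m)) := by
    intro w hw
    rw [mem_closedBall_iff_norm]
    calc ‖h w - h z‖ ≤ ‖h w‖ + ‖h z‖ := norm_sub_le _ _
      _ ≤ C * ‖w - c‖ ^ m + C * ‖z - c‖ ^ m :=
        add_le_add (hsize (hmem hw)) (hsize (hmem (mem_ball_self hpos)))
      _ ≤ C * (2 * ‖z - c‖) ^ m + C * ‖z - c‖ ^ m := by gcongr; exact hnorm hw
      _ = C * (2 ^ m + 1) * ‖z - c‖ ^ m := by ring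
  have hschwarz := Complex.dist_le_div_mul_dist_of_mapsTo_ball
    (fun w hw ↦ (hball w (hmem hw)).2.differentiableWithinAt) hmaps
    (z := ψ z) (by rw [mem_ball_iff_norm]; linarith)
  rw [dist_eq_norm, dist_eq_norm] at hschwarz
  calc ‖h (ψ z) - h z‖
      ≤ C * (2 ^ m + 1) * ‖z - c‖ ^ m / ‖z - c‖ * (ε / (C * (2 ^ m + 1)) * ‖z - c‖) :=
        hschwarz.trans (by gcongr)
    _ = ε * ‖‖z - c‖ ^ m‖ := by
      rw [norm_pow, norm_norm]
      field_simp

/-- If a holomorphic self-map of a bounded open set is tangent to the identity at a fixed point,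
then it agrees with the identity to infinite order there. -/
theorem isLittleO_sub_self_pow {Ω : Set E} (hΩ : IsOpen Ω) (hb : Bornology.IsBounded Ω)
    {φ : E → E} (hd : DifferentiableOn ℂ φ Ω) (hmaps : MapsTo φ Ω Ω) {c : E} (hc : c ∈ Ω)
    (hfix : φ c = c) (hderiv : HasFDerivAt φ (ContinuousLinearMap.id ℂ E) c) (k : ℕ) :
    (fun z ↦ φ z - z) =o[𝓝 c] fun z ↦ ‖z - c‖ ^ k := by
  obtain ⟨M, hM⟩ := hb.exists_norm_le
  obtain ⟨r, hr, hball⟩ := Metric.isOpen_iff.1 hΩ c hc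
  have hfix_iter (N : ℕ) : φ^[N] c = c := Function.iterate_fixed hfix N
  have htangent (N : ℕ) : (fun z ↦ φ^[N] z - z) =o[𝓝 c] fun z ↦ z - c := by
    have := (hderiv.iterate hfix N).isLittleO
    rw [← ContinuousLinearMap.one_def, one_pow] at this
    simpa [hfix_iter N] using this
  -- The bound supplied by the Schwarz lemma does not depend on the iterate.
  have hschwarz (N k : ℕ) (ho : (fun z ↦ φ^[N] z - z) =o[𝓝 c] fun z ↦ ‖z - c‖ ^ k) :
      ∀ z ∈ ball c r, ‖φ^[N] z - z‖ ≤ 2 * M / r ^ (k + 1) * ‖z - c‖ ^ (k + 1) := by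
    intro z hz
    have := Complex.dist_le_mul_div_pow_of_mapsTo_ball_of_isLittleO
      (f := fun z ↦ φ^[N] z - z) (R₂ := 2 * M) (n := k)
      (((hd.iterate hmaps N).sub differentiableOn_id).mono hball)
      (fun w hw ↦ by
        have h₁ := hM _ (hmaps.iterate N (hball hw))
        have h₂ := hM _ (hball hw)
        simpa [hfix_iter N] using (norm_sub_le (φ^[N] w) w).trans (by linarith))
      (by simpa [hfix_iter N] using ho) hz
    rw [div_mul_eq_mul_div, mul_div_assoc, ← div_pow]
    simpa [hfix_iter N, dist_eq_norm] using this
  induction k with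
  | zero =>
    have : ContinuousAt (fun z ↦ φ z - z) c := hderiv.continuousAt.sub continuousAt_id
    simpa [ContinuousAt, hfix] using this
  | succ k ih =>
    have hO (N : ℕ) (ho : (fun z ↦ φ^[N] z - z) =o[𝓝 c] fun z ↦ ‖z - c‖ ^ k) :
        (fun z ↦ φ^[N] z - z) =O[𝓝 c] fun z ↦ ‖z - c‖ ^ (k + 1) := by
      refine .of_bound (2 * M / r ^ (k + 1)) ?_
      filter_upwards [ball_mem_nhds c hr] with z hz
      simpa using hschwarz N k ho z hz
    have hO₁ : (fun z ↦ φ z - z) =O[𝓝 c] fun z ↦ ‖z - c‖ ^ (k + 1) := hO 1 ih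
    have hdiff : ∀ᶠ z in 𝓝 c, DifferentiableAt ℂ (fun z ↦ φ z - z) z := by
      filter_upwards [hΩ.mem_nhds hc] with z hz
      exact (hd.differentiableAt (hΩ.mem_nhds hz)).sub differentiableAt_id
    have hiter (N : ℕ) : (fun z ↦ φ^[N] z - z - N • (φ z - z)) =o[𝓝 c]
        fun z ↦ ‖z - c‖ ^ (k + 1) := by
      induction N with
      | zero => simp
      | succ N ihN =>
        refine (ihN.add (isLittleO_comp_sub_self hdiff hO₁ (htangent N))).congr_left fun z ↦ ?_
        rw [Function.iterate_succ_apply', succ_nsmul]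
        abel
    have hpow : (fun z ↦ ‖z - c‖ ^ (k + 1)) =o[𝓝 c] fun z ↦ ‖z - c‖ ^ k := by
      have hto : Tendsto (fun z ↦ ‖z - c‖) (𝓝 c) (𝓝 0) := tendsto_norm_sub_self c
      exact (isLittleO_pow_pow k.lt_succ_self).comp_tendsto hto
    have hlow (N : ℕ) : (fun z ↦ φ^[N] z - z) =o[𝓝 c] fun z ↦ ‖z - c‖ ^ k := by
      refine (((hiter N).trans hpow).add (ih.const_smul_left (N : ℂ))).congr_left fun z ↦ ?_
      simp [Nat.cast_smul_eq_nsmul]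
    have hM₀ : 0 ≤ M := (norm_nonneg c).trans (hM c hc)
    rw [isLittleO_iff]
    intro ε hε
    obtain ⟨N, hN⟩ := exists_nat_gt ((2 * M / r ^ (k + 1) + 1) / ε)
    have hN₀ : (0 : ℝ) < N := lt_of_le_of_lt (by positivity) hN
    filter_upwards [isLittleO_iff.1 (hiter N) one_pos, ball_mem_nhds c hr] with z hz hzr
    have hz' := hschwarz N k (hlow N) z hzr
    rw [norm_pow, norm_norm] at hz ⊢
    have hNz : N * ‖φ z - z‖ ≤ (2 * M / r ^ (k + 1) + 1) * ‖z - c‖ ^ (k + 1) := by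
      have : ‖N • (φ z - z)‖ = N * ‖φ z - z‖ := by
        rw [← Nat.cast_smul_eq_nsmul ℂ, norm_smul, Complex.norm_natCast]
      rw [← this]
      have := norm_sub_le (φ^[N] z - z) (φ^[N] z - z - N • (φ z - z))
      rw [sub_sub_cancel] at this
      linarith
    rw [div_lt_iff₀ hε] at hN
    refine le_of_mul_le_mul_left (hNz.trans ?_) hN₀
    rw [← mul_assoc]
    gcongr

end NormedSpace

/-- **H. Cartan's uniqueness theorem.**  Let `Ω ⊆ ℂⁿ` be a bounded connected
open set and `P ∈ Ω`.  If `φ : Ω → Ω` is holomorphic with `φ(P) = P` and its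
complex Fréchet derivative at `P` is the identity, then `φ` is the identity
map on `Ω`. -/
theorem cartan_uniqueness {n : ℕ}
    (Ω : Set (EuclideanSpace ℂ (Fin n)))
    (hΩ_open : IsOpen Ω) (hΩ_conn : IsConnected Ω)
    (hΩ_bdd : Bornology.IsBounded Ω)
    (P : EuclideanSpace ℂ (Fin n)) (hP : P ∈ Ω)
    (φ : EuclideanSpace ℂ (Fin n) → EuclideanSpace ℂ (Fin n))
    (hφ : DifferentiableOn ℂ φ Ω)
    (hmaps : Set.MapsTo φ Ω Ω)
    (hfix : φ P = P)
    (hderiv : fderiv ℂ φ P = ContinuousLinearMap.id ℂ (EuclideanSpace ℂ (Fin n))) :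
    ∀ z ∈ Ω, φ z = z := by
  have hdiff : HasFDerivAt φ (ContinuousLinearMap.id ℂ (EuclideanSpace ℂ (Fin n))) P :=
    hderiv ▸ (hφ.differentiableAt (hΩ_open.mem_nhds hP)).hasFDerivAt
  obtain ⟨r, hr, hball⟩ := Metric.isOpen_iff.1 hΩ_open P hP
  obtain ⟨M, hM⟩ := hΩ_bdd.exists_norm_le
  have hd : DifferentiableOn ℂ (fun z ↦ φ z - z) Ω := hφ.sub differentiableOn_id
  have hlocal : EqOn (fun z ↦ φ z - z) 0 (ball P r) :=
    eqOn_zero_ball_of_forall_isLittleO (M := M + M) (hd.mono hball)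
      (fun z hz ↦ norm_sub_le_of_le (hM _ (hmaps (hball hz))) (hM _ (hball hz)))
      (by simp [hfix]) (isLittleO_sub_self_pow hΩ_open hΩ_bdd hφ hmaps hP hfix hdiff)
  intro z hz
  exact sub_eq_zero.1 (hd.eqOn_zero_of_preconnected_of_eventuallyEq hΩ_open
    hΩ_conn.isPreconnected hP (hlocal.eventuallyEq_of_mem (ball_mem_nhds P hr)) hz)
end

section
/- (Burns–Krantz theorem for the ball.) Let B be the open unit ball {z ∈ ℂⁿ : ‖z‖ < 1} with respect to the Euclidean (Hermitian) norm, and let 𝟏 = (1, 0, …, 0) be the distinguished boundary point. Let Φ : B → B be a holomorphic mapping such that Φ(z) = 𝟏 + (z − 𝟏) + O(‖z − 𝟏‖⁴) as z → 𝟏 in B; that is, there exist C > 0 and δ > 0 such that ‖Φ(z) − z‖ ≤ C·‖z − 𝟏‖⁴ for all z ∈ B with ‖z − 𝟏‖ < δ. Then Φ(z) = z for all z ∈ B. -/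
open Metric Set

open Filter Topology in
/-- Radii close to `1` satisfy any inequality `1 - ρ ^ 2 < ε`. -/
lemma exists_radius_lt_one {a ε : ℝ} (ha : a < 1) (hε : 0 < ε) :
    ∃ ρ, a < ρ ∧ ρ < 1 ∧ 1 - ρ ^ 2 < ε := by
  have hlim : Tendsto (fun ρ : ℝ => 1 - ρ ^ 2) (𝓝[<] 1) (𝓝 0) := by
    have : ContinuousAt (fun ρ : ℝ => 1 - ρ ^ 2) 1 := by fun_prop
    simpa [ContinuousAt] using this.tendsto.mono_left nhdsWithin_le_nhds
  have hev : ∀ᶠ ρ in 𝓝[<] (1 : ℝ), a < ρ ∧ ρ < 1 ∧ 1 - ρ ^ 2 < ε := by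
    filter_upwards [self_mem_nhdsWithin, hlim.eventually_lt_const hε,
      nhdsWithin_le_nhds (lt_mem_nhds ha)] with ρ h₁ h₂ h₃
    exact ⟨h₃, h₁, h₂⟩
  exact hev.exists

/-- A holomorphic map on the unit disc whose norm tends to zero at the boundary vanishes. -/
lemma eq_zero_of_sq_norm_le_one_sub_sq {F : Type*} [NormedAddCommGroup F] [NormedSpace ℂ F]
    {V : ℂ → F} {M : ℝ} (hM : 0 < M) (hV : DifferentiableOn ℂ V (ball 0 1))
    (hb : ∀ ζ ∈ ball (0 : ℂ) 1, ‖V ζ‖ ^ 2 ≤ M * (1 - ‖ζ‖ ^ 2)) :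
    ∀ ζ ∈ ball (0 : ℂ) 1, V ζ = 0 := by
  intro ζ hζ
  rw [mem_ball_zero_iff] at hζ
  refine norm_le_zero_iff.1 (le_of_forall_pos_le_add fun ε hε => ?_)
  obtain ⟨ρ, h₁, h₂, h₃⟩ := exists_radius_lt_one hζ (show 0 < ε ^ 2 / M by positivity)
  have hρ : 0 < ρ := (norm_nonneg _).trans_lt h₁
  rw [zero_add]
  refine Complex.norm_le_of_forall_mem_frontier_norm_le (isBounded_ball (x := (0 : ℂ)) (r := ρ))
    (hV.diffContOnCl_ball (closedBall_subset_ball h₂)) (fun z hz => ?_)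
    (subset_closure (mem_ball_zero_iff.2 h₁))
  rw [frontier_ball _ hρ.ne', mem_sphere_zero_iff_norm] at hz
  have h := hb z (mem_ball_zero_iff.2 (hz ▸ h₂))
  rw [hz] at h
  rw [lt_div_iff₀ hM] at h₃
  exact le_of_sq_le_sq (by linarith) hε.le

/-- A holomorphic function on the unit disc that is small near `1` and whose real part is bounded
below by minus the Poisson kernel at `1` has nonnegative real part. -/
lemma re_nonneg_of_neg_poisson_le {h : ℂ → ℂ} {K η : ℝ} (hK : 0 < K) (hη : 0 < η)
    (hd : DifferentiableOn ℂ h (ball 0 1))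
    (hnear : ∀ z ∈ ball (0 : ℂ) 1, ‖z - 1‖ < η → ‖h z‖ ≤ K * ‖z - 1‖ ^ 2)
    (hre : ∀ z ∈ ball (0 : ℂ) 1, -((1 - ‖z‖ ^ 2) / ‖z - 1‖ ^ 2) ≤ (h z).re) :
    ∀ z ∈ ball (0 : ℂ) 1, 0 ≤ (h z).re := by
  intro z hz
  rw [mem_ball_zero_iff] at hz
  refine le_of_forall_pos_le_add fun ε hε => ?_
  set r := min η (min 1 (ε / K)) with hr
  have hr₀ : 0 < r := by positivity
  have hr₁ : r ≤ 1 := (min_le_right _ _).trans (min_le_left _ _)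
  have hr₂ : K * r ≤ ε := by
    rw [← le_div_iff₀' hK]
    exact (min_le_right _ _).trans (min_le_right _ _)
  obtain ⟨ρ, h₁, h₂, h₃⟩ := exists_radius_lt_one hz (show 0 < ε * r ^ 2 by positivity)
  have hρ : 0 < ρ := (norm_nonneg _).trans_lt h₁
  have key : ‖Complex.exp (-h z)‖ ≤ Real.exp ε := by
    refine Complex.norm_le_of_forall_mem_frontier_norm_le (f := fun z => Complex.exp (-h z))
      (isBounded_ball (x := (0 : ℂ)) (r := ρ))
      (hd.neg.cexp.diffContOnCl_ball (closedBall_subset_ball h₂)) (fun w hw => ?_)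
      (subset_closure (mem_ball_zero_iff.2 h₁))
    rw [frontier_ball _ hρ.ne', mem_sphere_zero_iff_norm] at hw
    have hwB : w ∈ ball (0 : ℂ) 1 := mem_ball_zero_iff.2 (hw ▸ h₂)
    rw [Complex.norm_exp, Real.exp_le_exp, Complex.neg_re]
    rcases lt_or_ge ‖w - 1‖ r with hlt | hge
    · have h₄ := hnear w hwB (hlt.trans_le (min_le_left _ _))
      have h₅ := (neg_le_abs _).trans (Complex.abs_re_le_norm (h w))
      have h₆ : ‖w - 1‖ ^ 2 ≤ r := by nlinarith [norm_nonneg (w - 1)]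
      nlinarith
    · have h₄ := hre w hwB
      have h₅ : (1 - ‖w‖ ^ 2) / ‖w - 1‖ ^ 2 ≤ ε := by
        rw [div_le_iff₀ (by have := hr₀.trans_le hge; positivity), hw]
        have : r ^ 2 ≤ ‖w - 1‖ ^ 2 := by gcongr
        nlinarith
      linarith
  rw [Complex.norm_exp, Real.exp_le_exp, Complex.neg_re] at key
  linarith

/-- A boundary rigidity statement of Hopf type: a holomorphic function with nonnegative real part
which vanishes to second order at `1` vanishes identically. -/
lemma eq_zero_of_re_nonneg_of_norm_le_sq {h : ℂ → ℂ} {K η : ℝ} (hK : 0 < K) (hη : 0 < η)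
    (hd : DifferentiableOn ℂ h (ball 0 1))
    (hnear : ∀ z ∈ ball (0 : ℂ) 1, ‖z - 1‖ < η → ‖h z‖ ≤ K * ‖z - 1‖ ^ 2)
    (hre : ∀ z ∈ ball (0 : ℂ) 1, 0 ≤ (h z).re) :
    ∀ z ∈ ball (0 : ℂ) 1, h z = 0 := by
  have hradial : ∀ t : ℝ, 0 < t → t < 1 → t < η →
      ((1 - t : ℝ) : ℂ) ∈ ball (0 : ℂ) 1 ∧ ‖h (1 - t : ℝ)‖ ≤ K * t ^ 2 := by
    intro t ht₀ ht₁ htη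
    have hmem : ((1 - t : ℝ) : ℂ) ∈ ball (0 : ℂ) 1 := by
      rw [mem_ball_zero_iff, Complex.norm_real, Real.norm_eq_abs, abs_lt]
      constructor <;> linarith
    have hnorm : ‖((1 - t : ℝ) : ℂ) - 1‖ = t := by
      have : ((1 - t : ℝ) : ℂ) - 1 = ((-t : ℝ) : ℂ) := by push_cast; ring
      rw [this, Complex.norm_real, Real.norm_eq_abs, abs_neg, abs_of_pos ht₀]
    have := hnear _ hmem (by rwa [hnorm])
    rw [hnorm] at this
    exact ⟨hmem, this⟩
  have h0 : (0 : ℂ) ∈ ball (0 : ℂ) 1 := mem_ball_self one_pos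
  rcases (hd.analyticOnNhd isOpen_ball).is_constant_or_isOpen
    (convex_ball (0 : ℂ) 1).isPreconnected with ⟨w, hw⟩ | hopen
  · suffices w = 0 by simpa [this] using hw
    refine norm_le_zero_iff.1 (le_of_forall_pos_le_add fun ε hε => ?_)
    set t := min (η / 2) (min (1 / 2) (ε / K))
    have ht₀ : 0 < t := by positivity
    have ht₁ : t ≤ 1 / 2 := (min_le_right _ _).trans (min_le_left _ _)
    have ht₂ : t ≤ η / 2 := min_le_left _ _
    have ht₃ : K * t ≤ ε := by
      rw [← le_div_iff₀' hK]
      exact (min_le_right _ _).trans (min_le_right _ _)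
    obtain ⟨hm, hb⟩ := hradial t ht₀ (by linarith) (by linarith)
    rw [hw _ hm] at hb
    nlinarith [mul_pos hK ht₀]
  · exfalso
    have hpos : 0 < (h 0).re := by
      obtain ⟨ε, hε, hsub⟩ := Metric.isOpen_iff.1 (hopen _ subset_rfl isOpen_ball) (h 0)
        (mem_image_of_mem _ h0)
      obtain ⟨z, hz, hzε⟩ := hsub (show h 0 - ((ε / 2 : ℝ) : ℂ) ∈ ball (h 0) ε by
        rw [mem_ball, dist_eq_norm, sub_sub_cancel_left, norm_neg, Complex.norm_real,
          Real.norm_eq_abs, abs_of_pos (by positivity)]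
        linarith)
      have := hre z hz
      rw [hzε, Complex.sub_re, Complex.ofReal_re] at this
      linarith
    have hden : ∀ z ∈ ball (0 : ℂ) 1, h z + (starRingEnd ℂ) (h 0) ≠ 0 := by
      intro z hz heq
      have h₁ := congrArg Complex.re heq
      simp only [Complex.add_re, Complex.conj_re, Complex.zero_re] at h₁
      linarith [hre z hz]
    have hS : ∀ z ∈ ball (0 : ℂ) 1,
        ‖(h z - h 0) / (h z + (starRingEnd ℂ) (h 0))‖ ≤ ‖z‖ := by
      intro z hz
      refine Complex.norm_le_norm_of_mapsTo_ball
        (f := fun z => (h z - h 0) / (h z + (starRingEnd ℂ) (h 0))) (R := 1)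
        ((hd.sub_const _).div (hd.add_const _) hden) (fun w hw => ?_) (by simp)
        (mem_ball_zero_iff.1 hz)
      rw [mem_closedBall_zero_iff, norm_div, div_le_one (norm_pos_iff.2 (hden w hw))]
      refine le_of_sq_le_sq ?_ (norm_nonneg _)
      rw [Complex.sq_norm, Complex.sq_norm, Complex.normSq_apply, Complex.normSq_apply]
      simp only [Complex.add_re, Complex.conj_re, Complex.sub_re, Complex.add_im, Complex.conj_im,
        Complex.sub_im]
      nlinarith [mul_nonneg (hre w hw) hpos.le]
    have hn : 0 < ‖h 0‖ := norm_pos_iff.2 fun h₁ => by simp [h₁] at hpos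
    set t := min (η / 2) (min (1 / 2) (‖h 0‖ / (4 * K)))
    have ht₀ : 0 < t := by positivity
    have ht₁ : t ≤ 1 / 2 := (min_le_right _ _).trans (min_le_left _ _)
    have ht₂ : t ≤ η / 2 := min_le_left _ _
    have ht₃ : t * (4 * K) ≤ ‖h 0‖ := by
      rw [← le_div_iff₀ (by positivity)]
      exact (min_le_right _ _).trans (min_le_right _ _)
    obtain ⟨hm, hb⟩ := hradial t ht₀ (by linarith) (by linarith)
    have h₁ := hS _ hm
    rw [norm_div, div_le_iff₀ (norm_pos_iff.2 (hden _ hm)), Complex.norm_real, Real.norm_eq_abs,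
      abs_of_pos (by linarith)] at h₁
    have h₂ := norm_sub_norm_le (h 0) (h (1 - t : ℝ))
    have h₃ := norm_add_le (h (1 - t : ℝ)) ((starRingEnd ℂ) (h 0))
    rw [RCLike.norm_conj] at h₃
    rw [norm_sub_rev] at h₂
    have h₄ : (1 - t) * ‖h (1 - t : ℝ) + (starRingEnd ℂ) (h 0)‖ ≤
        (1 - t) * (‖h (1 - t : ℝ)‖ + ‖h 0‖) := by
      gcongr
      linarith
    have h₅ : t * ‖h 0‖ ≤ (2 - t) * (K * t ^ 2) := by
      nlinarith [mul_le_mul_of_nonneg_left hb (show 0 ≤ 2 - t by linarith)]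
    have h₆ : t * ‖h 0‖ ≤ t * ((2 - t) * (K * t)) := by linarith
    have h₇ := le_of_mul_le_mul_left h₆ ht₀
    nlinarith [mul_pos hK ht₀]

/-- The Burns–Krantz theorem for the unit disc. -/
theorem burns_krantz_disc {f : ℂ → ℂ} {C δ : ℝ} (hC : 0 < C) (hδ : 0 < δ)
    (hf : DifferentiableOn ℂ f (ball 0 1)) (hmaps : MapsTo f (ball 0 1) (ball 0 1))
    (hO : ∀ z ∈ ball (0 : ℂ) 1, ‖z - 1‖ < δ → ‖f z - z‖ ≤ C * ‖z - 1‖ ^ 4) :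
    ∀ z ∈ ball (0 : ℂ) 1, f z = z := by
  have hne : ∀ z ∈ ball (0 : ℂ) 1, 1 - z ≠ 0 := by
    intro z hz h
    rw [← sub_eq_zero.1 h] at hz
    simp at hz
  have hre : ∀ z : ℂ, ((1 + z) / (1 - z)).re = (1 - ‖z‖ ^ 2) / ‖z - 1‖ ^ 2 := by
    intro z
    rw [norm_sub_rev, Complex.sq_norm, Complex.sq_norm, Complex.div_re, Complex.normSq_apply z,
      ← add_div]
    congr 1
    simp
    ring
  have hd : DifferentiableOn ℂ (fun z => (1 + f z) / (1 - f z) - (1 + z) / (1 - z)) (ball 0 1) :=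
    ((hf.const_add 1).div (hf.const_sub 1) fun z hz => hne _ (hmaps hz)).sub
      ((differentiableOn_id.const_add 1).div (differentiableOn_id.const_sub 1) hne)
  have hdiff : ∀ z ∈ ball (0 : ℂ) 1, (1 + f z) / (1 - f z) - (1 + z) / (1 - z) =
      2 * (f z - z) / ((1 - f z) * (1 - z)) := by
    intro z hz
    have h₁ := hne z hz
    have h₂ := hne _ (hmaps hz)
    field_simp
    ring
  set η := min δ (min 1 (1 / (2 * C)))
  have hη : 0 < η := by positivity
  have hnear : ∀ z ∈ ball (0 : ℂ) 1, ‖z - 1‖ < η →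
      ‖(1 + f z) / (1 - f z) - (1 + z) / (1 - z)‖ ≤ 4 * C * ‖z - 1‖ ^ 2 := by
    intro z hz hlt
    have h₁ : ‖z - 1‖ < δ := hlt.trans_le (min_le_left _ _)
    have h₂ : ‖z - 1‖ < 1 := hlt.trans_le ((min_le_right _ _).trans (min_le_left _ _))
    have h₃ : ‖z - 1‖ * (2 * C) < 1 := by
      rw [← lt_div_iff₀ (by positivity)]
      exact hlt.trans_le ((min_le_right _ _).trans (min_le_right _ _))
    have h₄ := hO z hz h₁
    have h₅ : 0 < ‖z - 1‖ := by
      rw [norm_sub_rev]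
      exact norm_pos_iff.2 (hne z hz)
    set x := ‖z - 1‖
    have h₆ : x / 2 ≤ ‖1 - f z‖ := by
      have h₇ : x ≤ ‖f z - z‖ + ‖1 - f z‖ := by
        have := norm_add_le (f z - z) (1 - f z)
        rwa [show f z - z + (1 - f z) = 1 - z by ring, norm_sub_rev 1 z] at this
      have h₈ : C * x ^ 4 ≤ x / 2 := by
        have : x ^ 3 ≤ x := by simpa using pow_le_pow_of_le_one h₅.le h₂.le (show 1 ≤ 3 by norm_num)
        have : C * x ^ 3 ≤ 1 / 2 := by nlinarith
        nlinarith
      linarith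
    rw [hdiff z hz, norm_div, norm_mul, norm_mul, norm_sub_rev 1 z, Complex.norm_ofNat,
      div_le_iff₀ (mul_pos (by linarith) h₅)]
    calc 2 * ‖f z - z‖ ≤ 2 * (C * x ^ 4) := by gcongr
      _ = 4 * C * x ^ 2 * (x / 2 * x) := by ring
      _ ≤ 4 * C * x ^ 2 * (‖1 - f z‖ * x) := by gcongr
  have hpois : ∀ z ∈ ball (0 : ℂ) 1, -((1 - ‖z‖ ^ 2) / ‖z - 1‖ ^ 2) ≤
      ((1 + f z) / (1 - f z) - (1 + z) / (1 - z)).re := by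
    intro z hz
    rw [Complex.sub_re, hre, hre]
    have h₁ := mem_ball_zero_iff.1 (hmaps hz)
    have h₂ : 0 ≤ (1 - ‖f z‖ ^ 2) / ‖f z - 1‖ ^ 2 :=
      div_nonneg (by nlinarith [norm_nonneg (f z)]) (by positivity)
    linarith
  have hK : 0 < 4 * C := by positivity
  intro z hz
  have h₀ := eq_zero_of_re_nonneg_of_norm_le_sq hK hη hd hnear
    (re_nonneg_of_neg_poisson_le hK hη hd hnear hpois) z hz
  simpa [hdiff z hz, hne z hz, hne _ (hmaps hz), sub_eq_zero] using h₀

section Slices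

open scoped InnerProductSpace

variable {E : Type*} [NormedAddCommGroup E] [InnerProductSpace ℂ E] {c w z : E} {p : ℂ}

/-- The distance from `z` to the point of the slice `c + ℂ w` to which it is retracted. -/
lemma sq_norm_sub_slice (hcw : ⟪c, w⟫_ℂ = 0) (hnorm : ‖c‖ ^ 2 + ‖w‖ ^ 2 = 1)
    (hp : ⟪w, z⟫_ℂ = p * (1 - ⟪c, z⟫_ℂ)) :
    ‖z - (c + p • w)‖ ^ 2 = ‖z‖ ^ 2 - 1 + (1 - ‖p‖ ^ 2) * (1 + ‖z - c‖ ^ 2 - ‖z‖ ^ 2) := by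
  have h₁ : ‖c + p • w‖ ^ 2 = ‖c‖ ^ 2 + ‖p‖ ^ 2 * ‖w‖ ^ 2 := by
    rw [@norm_add_sq ℂ, inner_smul_right, hcw, norm_smul]
    simp
    ring
  have h₂ : RCLike.re ⟪z, c + p • w⟫_ℂ = RCLike.re ⟪z, c⟫_ℂ +
      ‖p‖ ^ 2 * (1 - RCLike.re ⟪z, c⟫_ℂ) := by
    rw [inner_add_right, inner_smul_right, ← inner_conj_symm z w, hp, ← inner_conj_symm z c,
      Complex.sq_norm, Complex.normSq_apply]
    simp
    ring
  rw [@norm_sub_sq ℂ, @norm_sub_sq ℂ _ _ _ _ z c, h₁, h₂]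
  linear_combination (‖p‖ ^ 2) * hnorm

lemma one_sub_inner_ne_zero (hc : ‖c‖ < 1) (hz : ‖z‖ < 1) : 1 - ⟪c, z⟫_ℂ ≠ 0 := by
  intro h
  have h₁ := norm_inner_le_norm (𝕜 := ℂ) c z
  rw [← sub_eq_zero.1 h, norm_one] at h₁
  nlinarith [norm_nonneg c, norm_nonneg z]

/-- The map `z ↦ ⟪w, z⟫ / (1 - ⟪c, z⟫)` sends the unit ball to the unit disc. -/
lemma norm_lt_one_of_inner_eq (hcw : ⟪c, w⟫_ℂ = 0) (hnorm : ‖c‖ ^ 2 + ‖w‖ ^ 2 = 1)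
    (hz : ‖z‖ < 1) (hp : ⟪w, z⟫_ℂ = p * (1 - ⟪c, z⟫_ℂ)) : ‖p‖ < 1 := by
  have h := sq_norm_sub_slice hcw hnorm hp
  have h₁ : ‖z‖ ^ 2 < 1 := by nlinarith [norm_nonneg z]
  by_contra! hle
  nlinarith [mul_nonneg (show 0 ≤ ‖p‖ ^ 2 - 1 by nlinarith)
    (show 0 ≤ 1 + ‖z - c‖ ^ 2 - ‖z‖ ^ 2 by nlinarith [sq_nonneg ‖z - c‖]),
    sq_nonneg ‖z - (c + p • w)‖]

/-- A self-map of the unit ball which is tangent to third order to the identity at the boundary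
point `c + w` fixes the disc `c + ζ w` pointwise. -/
lemma fixes_slice (hcw : ⟪c, w⟫_ℂ = 0) (hnorm : ‖c‖ ^ 2 + ‖w‖ ^ 2 = 1) (hw : w ≠ 0)
    {Φ : E → E} (hΦ : DifferentiableOn ℂ Φ (ball 0 1)) (hmaps : MapsTo Φ (ball 0 1) (ball 0 1))
    {C δ : ℝ} (hC : 0 < C) (hδ : 0 < δ)
    (hO : ∀ z ∈ ball (0 : E) 1, ‖z - (c + w)‖ < δ → ‖Φ z - z‖ ≤ C * ‖z - (c + w)‖ ^ 4) :
    ∀ ζ ∈ ball (0 : ℂ) 1, Φ (c + ζ • w) = c + ζ • w := by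
  have hw₀ : 0 < ‖w‖ := norm_pos_iff.2 hw
  have hw₁ : ‖w‖ ≤ 1 := by nlinarith [sq_nonneg ‖c‖]
  have hc₁ : ‖c‖ < 1 := by nlinarith [norm_nonneg c]
  have hmem : MapsTo (fun ζ : ℂ => c + ζ • w) (ball 0 1) (ball 0 1) := by
    intro ζ hζ
    rw [mem_ball_zero_iff] at hζ ⊢
    have h₁ : ‖c + ζ • w‖ ^ 2 = ‖c‖ ^ 2 + ‖ζ‖ ^ 2 * ‖w‖ ^ 2 := by
      rw [@norm_add_sq ℂ, inner_smul_right, hcw, norm_smul]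
      simp
      ring
    have h₂ : ‖ζ‖ ^ 2 < 1 := by nlinarith [norm_nonneg ζ]
    nlinarith [norm_nonneg (c + ζ • w), mul_pos hw₀ hw₀]
  have hG : DifferentiableOn ℂ (fun ζ : ℂ => Φ (c + ζ • w)) (ball 0 1) :=
    hΦ.comp (by fun_prop) hmem
  have hGm : ∀ ζ ∈ ball (0 : ℂ) 1, ‖Φ (c + ζ • w)‖ < 1 := fun ζ hζ =>
    mem_ball_zero_iff.1 (hmaps (hmem hζ))
  have hGne : ∀ ζ ∈ ball (0 : ℂ) 1, 1 - ⟪c, Φ (c + ζ • w)⟫_ℂ ≠ 0 := fun ζ hζ =>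
    one_sub_inner_ne_zero hc₁ (hGm ζ hζ)
  have hinner : ∀ v : E, DifferentiableOn ℂ (fun ζ : ℂ => ⟪v, Φ (c + ζ • w)⟫_ℂ) (ball 0 1) :=
    fun v => (innerSL ℂ v).differentiable.comp_differentiableOn hG
  have hfix : ∀ ζ ∈ ball (0 : ℂ) 1,
      ⟪w, Φ (c + ζ • w)⟫_ℂ / (1 - ⟪c, Φ (c + ζ • w)⟫_ℂ) = ζ := by
    refine burns_krantz_disc (C := 2 * C / (1 - ‖c‖))
      (f := fun ζ => ⟪w, Φ (c + ζ • w)⟫_ℂ / (1 - ⟪c, Φ (c + ζ • w)⟫_ℂ))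
      (div_pos (by positivity) (by linarith)) hδ ((hinner w).div ((hinner c).const_sub 1) hGne)
      (fun ζ hζ => ?_) (fun ζ hζ hlt => ?_)
    · exact mem_ball_zero_iff.2 (norm_lt_one_of_inner_eq hcw hnorm (hGm ζ hζ)
        (div_mul_cancel₀ _ (hGne ζ hζ)).symm)
    · have hsub : ‖c + ζ • w - (c + w)‖ = ‖ζ - 1‖ * ‖w‖ := by
        rw [← norm_smul]
        congr 1
        module
      have hle : ‖c + ζ • w - (c + w)‖ ≤ ‖ζ - 1‖ := by
        rw [hsub]
        exact mul_le_of_le_one_right (norm_nonneg _) hw₁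
      have hD : ‖Φ (c + ζ • w) - (c + ζ • w)‖ ≤ C * ‖ζ - 1‖ ^ 4 :=
        (hO _ (hmem hζ) (hle.trans_lt hlt)).trans (by gcongr)
      have hwc : ⟪w, c⟫_ℂ = 0 := inner_eq_zero_symm.1 hcw
      have hnormC : (‖c‖ : ℂ) ^ 2 + (‖w‖ : ℂ) ^ 2 = 1 := by exact_mod_cast hnorm
      have hnum : ⟪w, Φ (c + ζ • w)⟫_ℂ / (1 - ⟪c, Φ (c + ζ • w)⟫_ℂ) - ζ =
          ⟪w, Φ (c + ζ • w) - (c + ζ • w)⟫_ℂ / (1 - ⟪c, Φ (c + ζ • w)⟫_ℂ) +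
          ζ * ⟪c, Φ (c + ζ • w) - (c + ζ • w)⟫_ℂ / (1 - ⟪c, Φ (c + ζ • w)⟫_ℂ) := by
        rw [← add_div, div_sub' (hGne ζ hζ)]
        congr 1
        simp only [inner_sub_right, inner_add_right, inner_smul_right, hcw, hwc,
          inner_self_eq_norm_sq_to_K]
        simp only [Complex.coe_algebraMap]
        linear_combination ζ * hnormC
      have hden : 1 - ‖c‖ ≤ ‖1 - ⟪c, Φ (c + ζ • w)⟫_ℂ‖ := by
        have h₁ := norm_inner_le_norm (𝕜 := ℂ) c (Φ (c + ζ • w))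
        have h₂ := norm_sub_norm_le 1 ⟪c, Φ (c + ζ • w)⟫_ℂ
        rw [norm_one] at h₂
        nlinarith [hGm ζ hζ, norm_nonneg c]
      have hζ' := mem_ball_zero_iff.1 hζ
      set D := Φ (c + ζ • w) - (c + ζ • w)
      have hw₂ : ‖⟪w, D⟫_ℂ‖ ≤ ‖D‖ := (norm_inner_le_norm w D).trans
        (mul_le_of_le_one_left (norm_nonneg _) hw₁)
      have hc₂ : ‖ζ * ⟪c, D⟫_ℂ‖ ≤ ‖D‖ := by
        rw [norm_mul]
        exact (mul_le_of_le_one_left (norm_nonneg _) hζ'.le).trans ((norm_inner_le_norm c D).trans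
          (mul_le_of_le_one_left (norm_nonneg _) hc₁.le))
      have hc₃ : 0 < 1 - ‖c‖ := by linarith
      rw [hnum, ← add_div, norm_div]
      calc _ ≤ (2 * (C * ‖ζ - 1‖ ^ 4)) / (1 - ‖c‖) := by
            gcongr
            linarith [norm_add_le ⟪w, D⟫_ℂ (ζ * ⟪c, D⟫_ℂ)]
        _ = _ := by ring
  have hzero := eq_zero_of_sq_norm_le_one_sub_sq (M := 5)
    (V := fun ζ : ℂ => Φ (c + ζ • w) - (c + ζ • w)) (by norm_num) (hG.sub (by fun_prop))
    fun ζ hζ => by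
      have h₁ := sq_norm_sub_slice hcw hnorm ((div_eq_iff (hGne ζ hζ)).1 (hfix ζ hζ))
      have h₂ := hGm ζ hζ
      have h₃ := mem_ball_zero_iff.1 hζ
      have h₄ := norm_sub_le (Φ (c + ζ • w)) c
      have h₅ : ‖Φ (c + ζ • w) - c‖ ^ 2 ≤ 4 := by
        nlinarith [norm_nonneg (Φ (c + ζ • w) - c)]
      have h₆ : 0 ≤ 1 - ‖ζ‖ ^ 2 := by nlinarith [norm_nonneg ζ]
      have h₇ : ‖Φ (c + ζ • w)‖ ^ 2 ≤ 1 := by nlinarith [norm_nonneg (Φ (c + ζ • w))]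
      rw [h₁]
      nlinarith [mul_le_mul_of_nonneg_left h₅ h₆, sq_nonneg ‖Φ (c + ζ • w)‖,
        mul_nonneg h₆ (sq_nonneg ‖Φ (c + ζ • w)‖)]
  exact fun ζ hζ => sub_eq_zero.1 (hzero ζ hζ)

/-- Every point of the unit ball lies on a slice `c + ζ w` whose boundary contains the given
boundary point `e = c + w`. -/
lemma exists_slice {e : E} (he : ‖e‖ = 1) (hz : ‖z‖ < 1) :
    ∃ (c w : E) (ζ : ℂ), ⟪c, w⟫_ℂ = 0 ∧ ‖c‖ ^ 2 + ‖w‖ ^ 2 = 1 ∧ w ≠ 0 ∧ e = c + w ∧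
      ‖ζ‖ < 1 ∧ z = c + ζ • w := by
  have hv : e - z ≠ 0 := fun h => by
    rw [← sub_eq_zero.1 h] at hz
    exact hz.ne he
  have hvv : ⟪e - z, e - z⟫_ℂ ≠ 0 := inner_self_ne_zero.2 hv
  have hve : ⟪e - z, e⟫_ℂ ≠ 0 := by
    intro h
    have h₁ := norm_inner_le_norm (𝕜 := ℂ) z e
    rw [inner_sub_left, sub_eq_zero] at h
    rw [← h, inner_self_eq_norm_sq_to_K, he] at h₁
    norm_num at h₁
    linarith
  set v := e - z with hv_def
  set τ := ⟪v, e⟫_ℂ / ⟪v, v⟫_ℂ with hτ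
  have hτ₀ : τ ≠ 0 := div_ne_zero hve hvv
  have hvc : ⟪v, e - τ • v⟫_ℂ = 0 := by
    rw [inner_sub_right, inner_smul_right, hτ, div_mul_cancel₀ _ hvv, sub_self]
  have hcv : ⟪e - τ • v, v⟫_ℂ = 0 := inner_eq_zero_symm.1 hvc
  have hcw : ⟪e - τ • v, τ • v⟫_ℂ = 0 := by rw [inner_smul_right, hcv, mul_zero]
  have hpyth : ∀ ζ : ℂ, ‖e - τ • v + ζ • τ • v‖ ^ 2 =
      ‖e - τ • v‖ ^ 2 + ‖ζ‖ ^ 2 * ‖τ • v‖ ^ 2 := by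
    intro ζ
    rw [@norm_add_sq ℂ, inner_smul_right, hcw, norm_smul ζ]
    simp
    ring
  have hw : τ • v ≠ 0 := smul_ne_zero hτ₀ hv
  have hnorm : ‖e - τ • v‖ ^ 2 + ‖τ • v‖ ^ 2 = 1 := by
    have := hpyth 1
    rw [one_smul, sub_add_cancel, he] at this
    simpa using this.symm
  have hzeq : z = e - τ • v + (1 - τ⁻¹) • τ • v := by
    rw [sub_smul, one_smul, inv_smul_smul₀ hτ₀, hv_def]
    abel
  refine ⟨e - τ • v, τ • v, 1 - τ⁻¹, hcw, hnorm, hw, (sub_add_cancel _ _).symm, ?_, hzeq⟩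
  have h₁ := hpyth (1 - τ⁻¹)
  rw [← hzeq] at h₁
  have h₂ : 0 < ‖τ • v‖ := norm_pos_iff.2 hw
  have h₃ : ‖z‖ ^ 2 < 1 := by nlinarith [norm_nonneg z]
  by_contra! hle
  nlinarith [mul_le_mul_of_nonneg_right (show 1 ≤ ‖1 - τ⁻¹‖ ^ 2 by nlinarith) (sq_nonneg ‖τ • v‖)]

end Slices

/-- **Burns–Krantz theorem for the unit ball in ℂⁿ.**  Let `B` be the open unit
ball of `ℂⁿ` (Euclidean norm) and `𝟏 = (1,0,…,0)` the distinguished boundary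
point.  If `Φ : B → B` is holomorphic and `Φ(z) = 𝟏 + (z - 𝟏) + O(‖z - 𝟏‖⁴)`
as `z → 𝟏`, i.e. there are `C > 0` and `δ > 0` with `‖Φ(z) - z‖ ≤ C ‖z - 𝟏‖⁴`
for all `z` in the ball with `‖z - 𝟏‖ < δ`, then `Φ` is the identity. -/
theorem burns_krantz_ball {n : ℕ} (hn : 0 < n)
    (Φ : EuclideanSpace ℂ (Fin n) → EuclideanSpace ℂ (Fin n))
    (hΦ : DifferentiableOn ℂ Φ (ball (0 : EuclideanSpace ℂ (Fin n)) 1))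
    (hmaps : Set.MapsTo Φ (ball (0 : EuclideanSpace ℂ (Fin n)) 1)
      (ball (0 : EuclideanSpace ℂ (Fin n)) 1))
    (one : EuclideanSpace ℂ (Fin n))
    (hone : one = EuclideanSpace.single (⟨0, hn⟩ : Fin n) (1 : ℂ))
    (C δ : ℝ) (hC : 0 < C) (hδ : 0 < δ)
    (hO : ∀ z ∈ ball (0 : EuclideanSpace ℂ (Fin n)) 1,
      ‖z - one‖ < δ → ‖Φ z - z‖ ≤ C * ‖z - one‖ ^ 4) :
    ∀ z ∈ ball (0 : EuclideanSpace ℂ (Fin n)) 1, Φ z = z := by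
  intro z hz
  have he : ‖one‖ = 1 := by simp [hone]
  obtain ⟨c, w, ζ, hcw, hnorm, hw, rfl, hζ, rfl⟩ := exists_slice he (mem_ball_zero_iff.1 hz)
  exact fixes_slice hcw hnorm hw hΦ hmaps hC hδ hO ζ (mem_ball_zero_iff.2 hζ)
end
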